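/- Let b ∈ (1/2, 1), set θ = (b − 3/8)/b, θ₀ = θ/4 + (1−θ)(1−2b)/2 and r₀ = (1−2b)/2 + 3θ₀, and assume r₀ > 0 (this holds for b sufficiently close to 1/2). Let χ, ψ ∈ C_c^∞(ℝ). There exists a constant C = C(b,χ,ψ) such that for every δ ∈ (0,1) and every v : 𝕋 × ℝ → ℂ smooth and compactly supported in the time variable, setting v_δ(x,t) = ψ(t/δ) v(x,t), the Duhamel expression g(x,t) = χ(t/δ) ∫_0^t ( e^{i(t−t')Δ} ( |v_δ(·,t')|² v_δ(·,t') ) )(x) dt' satisfies ‖g‖_{X^{0,b}} ≤ C δ^{r₀} ‖v‖_{X^{0,b}}³. -/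

import Mathlib

open MeasureTheory

/-- The `k`-th Fourier coefficient `Φ̂(k) = ∫_𝕋 Φ(x) e^{-2πikx} dx` of a 1-periodic
function `Φ : ℝ → ℂ`. -/
noncomputable def torusCoeff (Φ : ℝ → ℂ) (k : ℤ) : ℂ :=
  ∫ x in (0:ℝ)..1, Φ x * Complex.exp (-(2 * (Real.pi : ℂ)) * Complex.I * (k : ℂ) * (x : ℂ))

/-- The spacetime Fourier transform `f̃(k,η) = ∫_ℝ ∫_𝕋 f(x,t) e^{-2πi(kx+ηt)} dx dt` of
`f : 𝕋 × ℝ → ℂ` (a function `ℝ → ℝ → ℂ`, 1-periodic in the first variable). -/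
noncomputable def stFT (f : ℝ → ℝ → ℂ) (k : ℤ) (η : ℝ) : ℂ :=
  ∫ t : ℝ, ∫ x in (0:ℝ)..1,
    f x t * Complex.exp (-(2 * (Real.pi : ℂ)) * Complex.I * ((k : ℂ) * (x : ℂ) + (η : ℂ) * (t : ℂ)))

/-- The `X^{σ,b}` norm
`‖f‖_{X^{σ,b}} = (∑ₖ ∫ (1+|2πk|)^{2σ} (1+|η+2πk²|)^{2b} |f̃(k,η)|² dη)^{1/2}`,
valued in `ℝ≥0∞`. -/
noncomputable def XNorm (σ b : ℝ) (f : ℝ → ℝ → ℂ) : ENNReal :=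
  (∑' k : ℤ, ∫⁻ η : ℝ, ENNReal.ofReal
      ((1 + |2 * Real.pi * (k : ℝ)|) ^ (2 * σ) *
        (1 + |η + 2 * Real.pi * (k : ℝ) ^ 2|) ^ (2 * b) * ‖stFT f k η‖ ^ 2)) ^ ((1:ℝ)/2)

/-- The Sobolev norm `‖Φ‖_{H^σ} = (∑ₖ (1+|2πk|)^{2σ} |Φ̂(k)|²)^{1/2}`, valued in `ℝ≥0∞`. -/
noncomputable def HNorm (σ : ℝ) (Φ : ℝ → ℂ) : ENNReal :=
  (∑' k : ℤ, ENNReal.ofReal ((1 + |2 * Real.pi * (k : ℝ)|) ^ (2 * σ) * ‖torusCoeff Φ k‖ ^ 2))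
    ^ ((1:ℝ)/2)

/-- `f : 𝕋 × ℝ → ℂ` smooth (1-periodic in space) and compactly supported in time. -/
def SmoothCptTime (f : ℝ → ℝ → ℂ) : Prop :=
  ContDiff ℝ (⊤ : ℕ∞) (fun p : ℝ × ℝ => f p.1 p.2) ∧ (∀ x t, f (x + 1) t = f x t) ∧
    ∃ T : ℝ, ∀ x t : ℝ, T ≤ |t| → f x t = 0


/-- The free Schrödinger propagator on `𝕋`: `(e^{isΔ}Φ)(x) = ∑ₖ Φ̂(k) e^{2πikx - 4π²ik²s}`. -/
noncomputable def schrodingerProp (s : ℝ) (Φ : ℝ → ℂ) (x : ℝ) : ℂ :=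
  ∑' k : ℤ, torusCoeff Φ k *
    Complex.exp (2 * (Real.pi : ℂ) * Complex.I * (k : ℂ) * (x : ℂ) -
      4 * (Real.pi : ℂ) ^ 2 * Complex.I * (k : ℂ) ^ 2 * (s : ℂ))


section abstractPart
open scoped ENNReal

lemma cs_sq {α : Type*} [MeasurableSpace α] (μ : Measure α) {f g : α → ℝ≥0∞}
    (hf : AEMeasurable f μ) (hg : AEMeasurable g μ) :
    (∫⁻ a, f a * g a ∂μ) ^ 2 ≤ (∫⁻ a, f a ^ 2 ∂μ) * (∫⁻ a, g a ^ 2 ∂μ) := by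
  have h := ENNReal.lintegral_mul_le_Lp_mul_Lq μ Real.HolderConjugate.two_two hf hg
  simp only [Pi.mul_apply, ENNReal.rpow_two] at h
  calc (∫⁻ a, f a * g a ∂μ) ^ 2
      ≤ ((∫⁻ a, f a ^ 2 ∂μ) ^ ((1:ℝ)/2) * (∫⁻ a, g a ^ 2 ∂μ) ^ ((1:ℝ)/2)) ^ 2 := by gcongr
    _ = _ := by
      rw [mul_pow, ← ENNReal.rpow_two, ← ENNReal.rpow_two, ← ENNReal.rpow_mul, ← ENNReal.rpow_mul]
      norm_num

/-- Weighted Cauchy-Schwarz: `(∫ k h)² ≤ (∫ k h²)(∫ k)` -/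
lemma cs_weight {α : Type*} [MeasurableSpace α] (μ : Measure α) {k h : α → ℝ≥0∞}
    (hk : Measurable k) (hh : Measurable h) :
    (∫⁻ a, k a * h a ∂μ) ^ 2 ≤ (∫⁻ a, k a * h a ^ 2 ∂μ) * (∫⁻ a, k a ∂μ) := by
  have h1 := cs_sq μ (f := fun a => k a ^ ((1:ℝ)/2) * h a) (g := fun a => k a ^ ((1:ℝ)/2))
    (by fun_prop) (by fun_prop)
  have e : ∀ x : ℝ≥0∞, x ^ ((1:ℝ)/2) * x ^ ((1:ℝ)/2) = x := by
    intro x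
    rw [← ENNReal.rpow_add_of_nonneg _ _ (by norm_num) (by norm_num)]; norm_num
  have e2 : ∀ x : ℝ≥0∞, (x ^ ((1:ℝ)/2)) ^ 2 = x := by
    intro x; rw [pow_two, e]
  simp only [mul_pow, e2] at h1
  refine le_trans (le_of_eq ?_) h1
  congr 2; ext a
  rw [mul_right_comm, e]

/-- Bilinear convolution estimate on a group. -/
lemma bilinear_conv {G : Type*} [AddCommGroup G] [MeasurableSpace G] [MeasurableAdd₂ G]
    [MeasurableNeg G] (μ : Measure G) [SFinite μ] [μ.IsAddLeftInvariant]
    {P w f g : G → ℝ≥0∞} (hP : Measurable P) (hw : Measurable w) (hf : Measurable f)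
    (hg : Measurable g) (hPw : ∀ x, P x * w x = 1) {M : ℝ≥0∞}
    (hM : ∀ z, ∫⁻ y, P y * P (z - y) ∂μ ≤ M) :
    ∫⁻ z, (∫⁻ y, f y * g (z - y) ∂μ) ^ 2 ∂μ
      ≤ M * (∫⁻ y, w y * f y ^ 2 ∂μ) * (∫⁻ y, w y * g y ^ 2 ∂μ) := by
  have e2 : ∀ x : ℝ≥0∞, (x ^ ((1:ℝ)/2)) ^ 2 = x := by
    intro x; rw [← ENNReal.rpow_two, ← ENNReal.rpow_mul]; norm_num
  have key : ∀ z, (∫⁻ y, f y * g (z - y) ∂μ) ^ 2 ≤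
      M * ∫⁻ y, (w y * f y ^ 2) * (w (z - y) * g (z - y) ^ 2) ∂μ := by
    intro z
    have h1 := cs_sq μ (f := fun y => (P y * P (z - y)) ^ ((1:ℝ)/2))
      (g := fun y => (w y * w (z - y)) ^ ((1:ℝ)/2) * (f y * g (z - y)))
      (by fun_prop) (by fun_prop)
    simp only [mul_pow _ _ 2, e2] at h1
    have : ∀ y, (P y * P (z - y)) ^ ((1:ℝ)/2) *
        ((w y * w (z - y)) ^ ((1:ℝ)/2) * (f y * g (z - y))) = f y * g (z - y) := by
      intro y
      rw [← mul_assoc, ← ENNReal.mul_rpow_of_nonneg _ _ (by norm_num : (0:ℝ) ≤ 1/2)]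
      have : P y * P (z - y) * (w y * w (z - y)) = 1 := by
        rw [mul_mul_mul_comm, hPw, hPw, one_mul]
      rw [this]; simp
    simp only [this] at h1
    refine h1.trans ?_
    refine mul_le_mul' (hM z) (le_of_eq ?_)
    congr 1; ext y; ring
  calc ∫⁻ z, (∫⁻ y, f y * g (z - y) ∂μ) ^ 2 ∂μ
      ≤ ∫⁻ z, M * ∫⁻ y, (w y * f y ^ 2) * (w (z - y) * g (z - y) ^ 2) ∂μ ∂μ :=
        lintegral_mono key
    _ = M * ∫⁻ z, ∫⁻ y, (w y * f y ^ 2) * (w (z - y) * g (z - y) ^ 2) ∂μ ∂μ := by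
        rw [lintegral_const_mul]
        apply Measurable.lintegral_prod_right'
          (f := fun q : G × G => (w q.2 * f q.2 ^ 2) * (w (q.1 - q.2) * g (q.1 - q.2) ^ 2))
        fun_prop
    _ = M * ∫⁻ y, ∫⁻ z, (w y * f y ^ 2) * (w (z - y) * g (z - y) ^ 2) ∂μ ∂μ := by
        rw [lintegral_lintegral_swap]
        fun_prop
    _ = M * ∫⁻ y, (w y * f y ^ 2) * (∫⁻ z, w z * g z ^ 2 ∂μ) ∂μ := by
        congr 2; ext y
        rw [lintegral_const_mul _ (by fun_prop)]
        congr 1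
        exact lintegral_sub_right_eq_self (fun z => w z * g z ^ 2) y
    _ = _ := by
        rw [lintegral_mul_const _ (by fun_prop), mul_assoc]

/-- Trilinear estimate: abstract form. -/
lemma trilinear_conv {G : Type*} [AddCommGroup G] [MeasurableSpace G] [MeasurableAdd₂ G]
    [MeasurableNeg G] (μ : Measure G) [SFinite μ] [μ.IsAddLeftInvariant]
    {P w U A N : G → ℝ≥0∞} (hP : Measurable P) (hw : Measurable w) (hU : Measurable U)
    (hAm : Measurable A) (hNm : Measurable N)
    (hPw : ∀ x, P x * w x = 1) {M : ℝ≥0∞}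
    (hM : ∀ z, ∫⁻ y, P y * P (z - y) ∂μ ≤ M)
    (hA : ∀ z, A z ≤ ∫⁻ y, U y * U (z - y) ∂μ)
    (hN : ∀ z, N z ≤ ∫⁻ p, A p * U (p - z) ∂μ)
    (hfin : ∫⁻ z, P z * N z ^ 2 ∂μ ≠ ∞) :
    ∫⁻ z, P z * N z ^ 2 ∂μ ≤ M ^ 2 * (∫⁻ y, w y * U y ^ 2 ∂μ) ^ 3 := by
  set X := ∫⁻ z, P z * N z ^ 2 ∂μ with hX
  set E := ∫⁻ y, w y * U y ^ 2 ∂μ with hE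
  have h1 : X ≤ ∫⁻ p, A p * (∫⁻ z, (P z * N z) * U (p - z) ∂μ) ∂μ := by
    calc X = ∫⁻ z, (P z * N z) * N z ∂μ := by
          rw [hX]; congr 1; ext z; ring
      _ ≤ ∫⁻ z, (P z * N z) * ∫⁻ p, A p * U (p - z) ∂μ ∂μ := by
          gcongr with z; exact hN z
      _ = ∫⁻ z, ∫⁻ p, (P z * N z) * (A p * U (p - z)) ∂μ ∂μ := by
          congr 1; ext z; rw [lintegral_const_mul]; fun_prop
      _ = ∫⁻ p, ∫⁻ z, (P z * N z) * (A p * U (p - z)) ∂μ ∂μ := by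
          rw [lintegral_lintegral_swap]; fun_prop
      _ = _ := by
          congr 1; ext p; rw [← lintegral_const_mul]
          · congr 1; ext z; ring
          · fun_prop
  have hm : Measurable (fun p => ∫⁻ z, (P z * N z) * U (p - z) ∂μ) := by
    apply Measurable.lintegral_prod_right'
      (f := fun q : G × G => (P q.2 * N q.2) * U (q.1 - q.2))
    fun_prop
  have h2 := cs_sq μ hAm.aemeasurable hm.aemeasurable
  have h3 : ∫⁻ p, A p ^ 2 ∂μ ≤ M * E * E :=
    (lintegral_mono (fun p => pow_le_pow_left' (hA p) 2)).trans
      (bilinear_conv μ hP hw hU hU hPw hM)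
  have h4 : ∫⁻ p, (∫⁻ z, (P z * N z) * U (p - z) ∂μ) ^ 2 ∂μ ≤ M * X * E := by
    refine (bilinear_conv μ hP hw (hP.mul hNm) hU hPw hM).trans (le_of_eq ?_)
    congr 2
    rw [hX]; congr 1; ext y
    simp only [Pi.mul_apply]
    calc w y * (P y * N y) ^ 2 = (P y * w y) * (P y * N y ^ 2) := by ring
      _ = _ := by rw [hPw, one_mul]
  have h5 : X ^ 2 ≤ (M ^ 2 * E ^ 3) * X := by
    calc X ^ 2 ≤ _ := pow_le_pow_left' h1 2
      _ ≤ _ := h2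
      _ ≤ (M * E * E) * (M * X * E) := mul_le_mul' h3 h4
      _ = _ := by ring
  rcases eq_or_ne X 0 with h0 | h0
  · rw [h0]; exact zero_le
  · rw [pow_two] at h5
    exact (ENNReal.mul_le_mul_iff_left h0 hfin).1 h5

end abstractPart


section kernels
open scoped ENNReal

/-- One-dimensional weight. -/
noncomputable def jb (p x : ℝ) : ℝ≥0∞ := ENNReal.ofReal ((1 + |x|) ^ p)

lemma jb_meas (p : ℝ) : Measurable (jb p) := by
  unfold jb; fun_prop

lemma one_add_abs_pos (x : ℝ) : 0 < 1 + |x| := by positivity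
lemma one_le_one_add_abs (x : ℝ) : 1 ≤ 1 + |x| := by linarith [abs_nonneg x]

lemma jb_mul (p q x : ℝ) : jb p x * jb q x = jb (p + q) x := by
  unfold jb
  rw [← ENNReal.ofReal_mul (by positivity), Real.rpow_add (by positivity)]

lemma jb_zero (x : ℝ) : jb 0 x = 1 := by simp [jb]

lemma jb_mono {p q : ℝ} (h : p ≤ q) (x : ℝ) : jb p x ≤ jb q x := by
  unfold jb
  exact ENNReal.ofReal_le_ofReal (Real.rpow_le_rpow_of_exponent_le (one_le_one_add_abs x) h)

lemma jb_rpow (p x : ℝ) {q : ℝ} (hq : 0 ≤ q) : jb p x ^ q = jb (p * q) x := by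
  unfold jb
  rw [ENNReal.ofReal_rpow_of_nonneg (by positivity) hq, ← Real.rpow_mul (by positivity)]

lemma jb_sq (p x : ℝ) : jb p x ^ 2 = jb (2 * p) x := by
  rw [pow_two, jb_mul]; congr 1; ring

lemma jb_neg (p x : ℝ) : jb p (-x) = jb p x := by simp [jb]

lemma jb_int {p : ℝ} (hp : p < -1) : ∫⁻ x, jb p x < ∞ := by
  have h := integrable_one_add_norm (E := ℝ) (μ := volume) (r := -p) (by simp; linarith)
  have h2 := h.lintegral_lt_top
  simpa [jb] using h2

lemma lintegral_scale {f : ℝ → ℝ≥0∞} (hf : Measurable f) {δ : ℝ} (hδ : 0 < δ) :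
    ∫⁻ x, f (δ * x) = ENNReal.ofReal δ⁻¹ * ∫⁻ x, f x := by
  have h := Real.map_volume_mul_left hδ.ne'
  rw [← lintegral_map hf (by fun_prop : Measurable fun x : ℝ => δ * x), h, lintegral_smul_measure,
    abs_of_pos (inv_pos.2 hδ)]
  rfl

/-- the scaled kernel -/
noncomputable def Kd (δ x : ℝ) : ℝ≥0∞ := ENNReal.ofReal δ * jb (-2) (δ * x)

lemma Kd_meas (δ : ℝ) : Measurable (Kd δ) := by
  unfold Kd; exact ((jb_meas _).comp (by fun_prop)).const_mul _

noncomputable def C2 : ℝ≥0∞ := ∫⁻ x, jb (-2) x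
lemma C2_lt : C2 < ∞ := jb_int (by norm_num)

lemma Kd_int {δ : ℝ} (hδ : 0 < δ) : ∫⁻ x, Kd δ x = C2 := by
  unfold Kd C2
  have hmm : Measurable fun x : ℝ => jb (-2) (δ * x) := (jb_meas _).comp (by fun_prop)
  rw [lintegral_const_mul _ hmm, lintegral_scale (jb_meas _) hδ,
    ← mul_assoc, ← ENNReal.ofReal_mul hδ.le, mul_inv_cancel₀ hδ.ne']
  simp

lemma jb_scale {s δ : ℝ} (hs : 0 ≤ s) (hδ : 0 < δ) (hδ1 : δ < 1) (x : ℝ) :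
    jb s x ≤ ENNReal.ofReal (δ ^ (-s)) * jb s (δ * x) := by
  unfold jb
  rw [← ENNReal.ofReal_mul (by positivity)]
  apply ENNReal.ofReal_le_ofReal
  have h : 1 + |x| ≤ δ⁻¹ * (1 + |δ * x|) := by
    rw [abs_mul, abs_of_pos hδ, mul_add, ← mul_assoc, inv_mul_cancel₀ hδ.ne']
    have := (one_le_inv₀ hδ).2 hδ1.le
    linarith
  calc (1 + |x|) ^ s ≤ (δ⁻¹ * (1 + |δ * x|)) ^ s := by gcongr
    _ = _ := by
      rw [Real.mul_rpow (by positivity) (by positivity), Real.inv_rpow hδ.le, Real.rpow_neg hδ.le]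

lemma Kd_sq_int {s δ : ℝ} (hs : 0 ≤ s) (hs1 : s ≤ 1) (hδ : 0 < δ) (hδ1 : δ < 1) :
    ∫⁻ x, (jb s x * Kd δ x) ^ 2 ≤ ENNReal.ofReal (δ ^ (1 - 2 * s)) * C2 := by
  have h : ∀ x, (jb s x * Kd δ x) ^ 2 ≤
      ENNReal.ofReal (δ ^ (2 - 2 * s)) * jb (-2) (δ * x) := by
    intro x
    calc (jb s x * Kd δ x) ^ 2
        ≤ (ENNReal.ofReal (δ ^ (-s)) * jb s (δ * x) * Kd δ x) ^ 2 := by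
          gcongr; exact jb_scale hs hδ hδ1 x
      _ = (ENNReal.ofReal (δ ^ (-s)) * ENNReal.ofReal δ) ^ 2 *
            (jb s (δ * x) * jb (-2) (δ * x)) ^ 2 := by unfold Kd; ring
      _ ≤ _ := by
          gcongr
          · rw [← ENNReal.ofReal_mul (by positivity), ← ENNReal.ofReal_pow (by positivity)]
            apply le_of_eq; congr 1
            rw [← Real.rpow_add_one hδ.ne', ← Real.rpow_natCast, ← Real.rpow_mul hδ.le]
            congr 1; push_cast; ring
          · rw [jb_mul, jb_sq]; apply jb_mono; linarith
  refine (lintegral_mono h).trans ?_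
  have hmm : Measurable fun x : ℝ => jb (-2) (δ * x) := (jb_meas _).comp (by fun_prop)
  rw [lintegral_const_mul _ hmm, lintegral_scale (jb_meas _) hδ,
    ← mul_assoc, ← ENNReal.ofReal_mul (by positivity)]
  apply le_of_eq
  unfold C2
  congr 2
  rw [show 1 - 2 * s = (2 - 2*s) - 1 by ring, Real.rpow_sub_one hδ.ne']
  rfl

/-- L² * L¹ → L² -/
lemma young21 {k a : ℝ → ℝ≥0∞} (hk : Measurable k) (ha : Measurable a) :
    ∫⁻ x, (∫⁻ y, k (x - y) * a y) ^ 2 ≤ (∫⁻ x, k x ^ 2) * (∫⁻ y, a y) ^ 2 := by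
  calc ∫⁻ x, (∫⁻ y, k (x - y) * a y) ^ 2
      ≤ ∫⁻ x, (∫⁻ y, a y * k (x - y) ^ 2) * (∫⁻ y, a y) := by
        apply lintegral_mono; intro x
        have := cs_weight volume (k := a) (h := fun y => k (x - y)) ha (by fun_prop)
        simpa only [mul_comm (a _)] using this
    _ = (∫⁻ x, (∫⁻ y, a y * k (x - y) ^ 2)) * (∫⁻ y, a y) := by
        rw [lintegral_mul_const]
        apply Measurable.lintegral_prod_right' (f := fun q : ℝ × ℝ => a q.2 * k (q.1 - q.2) ^ 2)
        fun_prop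
    _ = (∫⁻ y, (∫⁻ x, a y * k (x - y) ^ 2)) * (∫⁻ y, a y) := by
        rw [lintegral_lintegral_swap]; fun_prop
    _ = (∫⁻ y, a y * (∫⁻ x, k x ^ 2)) * (∫⁻ y, a y) := by
        congr 2; ext y
        rw [lintegral_const_mul _ (by fun_prop)]
        congr 1
        exact lintegral_sub_right_eq_self (fun z => k z ^ 2) y
    _ = _ := by rw [lintegral_mul_const _ ha]; ring

/-- Schur-type: `k ∗ (m H)` with `sup ∫ k(x-y) m(y)^2 ≤ B`. -/
lemma young_schur {k m H : ℝ → ℝ≥0∞} (hk : Measurable k) (hm : Measurable m) (hH : Measurable H)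
    {B : ℝ≥0∞} (hB : ∀ x, ∫⁻ y, k (x - y) * m y ^ 2 ≤ B) :
    ∫⁻ x, (∫⁻ y, k (x - y) * (m y * H y)) ^ 2 ≤ B * (∫⁻ x, k x) * (∫⁻ y, H y ^ 2) := by
  have e : ∀ x : ℝ≥0∞, x ^ ((1:ℝ)/2) * x ^ ((1:ℝ)/2) = x := by
    intro x
    rw [← ENNReal.rpow_add_of_nonneg _ _ (by norm_num) (by norm_num)]; norm_num
  calc ∫⁻ x, (∫⁻ y, k (x - y) * (m y * H y)) ^ 2
      ≤ ∫⁻ x, B * (∫⁻ y, k (x - y) * H y ^ 2) := by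
        apply lintegral_mono; intro x
        have := cs_sq volume (f := fun y => k (x - y) ^ ((1:ℝ)/2) * m y)
          (g := fun y => k (x - y) ^ ((1:ℝ)/2) * H y) (by fun_prop) (by fun_prop)
        simp only [mul_pow, pow_two (_ ^ ((1:ℝ)/2)), e] at this
        simp only [mul_mul_mul_comm _ (m _), e] at this
        exact this.trans (mul_le_mul' (hB x) le_rfl)
    _ = B * ∫⁻ x, (∫⁻ y, k (x - y) * H y ^ 2) := by
        rw [lintegral_const_mul]
        apply Measurable.lintegral_prod_right' (f := fun q : ℝ × ℝ => k (q.1 - q.2) * H q.2 ^ 2)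
        fun_prop
    _ = B * ∫⁻ y, (∫⁻ x, k (x - y) * H y ^ 2) := by
        rw [lintegral_lintegral_swap]; fun_prop
    _ = B * ∫⁻ y, (∫⁻ x, k x) * H y ^ 2 := by
        congr 2; ext y
        rw [lintegral_mul_const _ (by fun_prop)]
        congr 1
        exact lintegral_sub_right_eq_self k y
    _ = _ := by rw [lintegral_const_mul _ (by fun_prop)]; ring

lemma jb_sub_le {s : ℝ} (hs : 0 ≤ s) (hs1 : s ≤ 1) (x y : ℝ) :
    jb s x ≤ jb s (x - y) + jb s y := by
  unfold jb
  rw [← ENNReal.ofReal_add (by positivity) (by positivity)]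
  apply ENNReal.ofReal_le_ofReal
  calc (1 + |x|) ^ s ≤ ((1 + |x - y|) + (1 + |y|)) ^ s := by
        have := abs_add_le (x - y) y
        rw [sub_add_cancel] at this
        apply Real.rpow_le_rpow (by positivity) (by linarith) hs
    _ ≤ _ := Real.rpow_add_le_add_rpow (by positivity) (by positivity) hs hs1

lemma sq_add_le (a c : ℝ≥0∞) : (a + c) ^ 2 ≤ 2 * a ^ 2 + 2 * c ^ 2 := by
  have := ENNReal.rpow_add_le_mul_rpow_add_rpow a c (p := 2) (by norm_num)
  simp only [ENNReal.rpow_two] at this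
  refine this.trans (le_of_eq ?_)
  norm_num; ring

/-- Fundamental product estimate. -/
lemma prod_est {s b δ : ℝ} (hs : 0 ≤ s) (hs1 : s ≤ 1) (hδ : 0 < δ) (hδ1 : δ < 1)
    {a : ℝ → ℝ≥0∞} (ha : Measurable a) {B : ℝ≥0∞}
    (hB : ∀ x, ∫⁻ y, Kd δ (x - y) * jb (s - b) y ^ 2 ≤ B) :
    ∫⁻ x, jb (2 * s) x * (∫⁻ y, Kd δ (x - y) * a y) ^ 2 ≤
      2 * C2 * (ENNReal.ofReal (δ ^ (1 - 2 * s)) * (∫⁻ y, jb (-2 * b) y) + B) *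
        ∫⁻ y, jb (2 * b) y * a y ^ 2 := by
  have hKm := Kd_meas δ
  have hj := jb_meas
  have hj1 := hj s
  have hj2 := hj b
  have hj3 := hj (-b)
  have hj4 := hj (s-b)
  set H := fun y => jb b y * a y with hH
  have hHm : Measurable H := by fun_prop
  have hH2 : ∫⁻ y, H y ^ 2 = ∫⁻ y, jb (2 * b) y * a y ^ 2 := by
    congr 1; ext y; simp only [hH, mul_pow, jb_sq]
  have hL1 : (∫⁻ y, a y) ^ 2 ≤ (∫⁻ y, jb (-2 * b) y) * ∫⁻ y, H y ^ 2 := by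
    have := cs_sq volume (f := fun y => jb (-b) y) (g := H) (by fun_prop) (by fun_prop)
    simp only [jb_sq, hH, ← mul_assoc, jb_mul, neg_add_cancel, jb_zero, one_mul] at this
    simpa [hH] using this
  have hpt : ∀ x, jb (2 * s) x * (∫⁻ y, Kd δ (x - y) * a y) ^ 2 ≤
      2 * (∫⁻ y, (jb s (x - y) * Kd δ (x - y)) * a y) ^ 2
      + 2 * (∫⁻ y, Kd δ (x - y) * (jb (s - b) y * H y)) ^ 2 := by
    intro x
    refine le_trans ?_ (sq_add_le _ _)
    rw [← jb_sq, ← mul_pow, ← lintegral_const_mul _ (by fun_prop), ← lintegral_add_left (by fun_prop)]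
    gcongr with y
    simp only [hH, ← mul_assoc (jb (s - b) y), jb_mul, sub_add_cancel]
    calc jb s x * (Kd δ (x - y) * a y) ≤ (jb s (x-y) + jb s y) * (Kd δ (x - y) * a y) := by
          gcongr; exact jb_sub_le hs hs1 x y
      _ = _ := by ring
  refine (lintegral_mono hpt).trans ?_
  have hm1 : Measurable fun x => (∫⁻ y, (jb s (x - y) * Kd δ (x - y)) * a y) := by
    apply Measurable.lintegral_prod_right'
      (f := fun q : ℝ × ℝ => (jb s (q.1 - q.2) * Kd δ (q.1 - q.2)) * a q.2)
    fun_prop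
  have hm2 : Measurable fun x => (∫⁻ y, Kd δ (x - y) * (jb (s - b) y * H y)) := by
    apply Measurable.lintegral_prod_right'
      (f := fun q : ℝ × ℝ => (Kd δ (q.1 - q.2)) * (jb (s - b) q.2 * H q.2))
    fun_prop
  rw [lintegral_add_left (by fun_prop), lintegral_const_mul _ (by fun_prop),
    lintegral_const_mul _ (by fun_prop)]
  have t1 := young21 (k := fun z => jb s z * Kd δ z) (a := a) (by fun_prop) ha
  have t2 := young_schur (k := Kd δ) (m := jb (s - b)) (H := H) hKm hj4 hHm hB
  rw [Kd_int hδ] at t2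
  have t3 := Kd_sq_int hs hs1 hδ hδ1
  rw [← hH2]
  calc _ ≤ 2 * ((ENNReal.ofReal (δ ^ (1 - 2 * s)) * C2) *
          ((∫⁻ y, jb (-2 * b) y) * ∫⁻ y, H y ^ 2)) + 2 * (B * C2 * (∫⁻ y, H y ^ 2)) := by
        gcongr
        exact t1.trans (mul_le_mul' t3 hL1)
    _ = _ := by ring

/-- product estimate for `s = b`. -/
lemma prod_est_b {b : ℝ} (hb : 1/2 < b) (hb1 : b < 1) : ∃ C : ℝ≥0∞, C < ∞ ∧
    ∀ δ : ℝ, 0 < δ → δ < 1 → ∀ a : ℝ → ℝ≥0∞, Measurable a →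
    ∫⁻ x, jb (2 * b) x * (∫⁻ y, Kd δ (x - y) * a y) ^ 2 ≤
      C * ENNReal.ofReal (δ ^ (1 - 2 * b)) * ∫⁻ y, jb (2 * b) y * a y ^ 2 := by
  have hfin : ∫⁻ y, jb (-2 * b) y < ∞ := jb_int (by linarith)
  refine ⟨2 * C2 * ((∫⁻ y, jb (-2 * b) y) + C2), ?_, ?_⟩
  · exact ENNReal.mul_lt_top (ENNReal.mul_lt_top (by simp) C2_lt)
      (ENNReal.add_lt_top.2 ⟨hfin, C2_lt⟩)
  intro δ hδ hδ1 a ha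
  have := prod_est (s := b) (b := b) (δ := δ) (by linarith) hb1.le hδ hδ1 ha (B := C2) (by
    intro x
    simp only [sub_self, jb_zero, one_pow, mul_one]
    rw [← Kd_int hδ]
    exact (lintegral_sub_left_eq_self (Kd δ) x).le)
  refine this.trans ?_
  gcongr ?_ * _
  have h1 : (1 : ℝ≥0∞) ≤ ENNReal.ofReal (δ ^ (1 - 2 * b)) := by
    rw [ENNReal.one_le_ofReal]
    exact Real.one_le_rpow_of_pos_of_le_one_of_nonpos hδ hδ1.le (by linarith)
  calc _ ≤ 2 * C2 * (ENNReal.ofReal (δ ^ (1 - 2 * b)) * (∫⁻ y, jb (-2 * b) y) +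
        ENNReal.ofReal (δ ^ (1 - 2 * b)) * C2) := by
        gcongr
        exact le_mul_of_one_le_left' h1
    _ = _ := by ring

/-- product estimate for `s = 2/5`. -/
lemma prod_est_s {b : ℝ} (hb : 1/2 < b) : ∃ C : ℝ≥0∞, C < ∞ ∧
    ∀ δ : ℝ, 0 < δ → δ < 1 → ∀ a : ℝ → ℝ≥0∞, Measurable a →
    ∫⁻ x, jb (4/5) x * (∫⁻ y, Kd δ (x - y) * a y) ^ 2 ≤
      C * ENNReal.ofReal (δ ^ ((1:ℝ)/8)) * ∫⁻ y, jb (2 * b) y * a y ^ 2 := by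
  have hfin : ∫⁻ y, jb (-2 * b) y < ∞ := jb_int (by linarith)
  have hfin2 : ∫⁻ y, jb (-8/5) y < ∞ := jb_int (by norm_num)
  set D : ℝ≥0∞ := C2 ^ ((7:ℝ)/8) * (∫⁻ y, jb (-8/5) y) ^ ((1:ℝ)/8) with hD
  have hDf : D < ∞ := ENNReal.mul_lt_top (ENNReal.rpow_lt_top_of_nonneg (by norm_num) C2_lt.ne)
    (ENNReal.rpow_lt_top_of_nonneg (by norm_num) hfin2.ne)
  refine ⟨2 * C2 * ((∫⁻ y, jb (-2 * b) y) + D), ?_, ?_⟩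
  · exact ENNReal.mul_lt_top (ENNReal.mul_lt_top (by simp) C2_lt)
      (ENNReal.add_lt_top.2 ⟨hfin, hDf⟩)
  intro δ hδ hδ1 a ha
  have hKm := Kd_meas δ
  have hj := jb_meas (-1/5)
  have hB : ∀ x, ∫⁻ y, Kd δ (x - y) * jb (2/5 - b) y ^ 2 ≤ ENNReal.ofReal (δ ^ ((1:ℝ)/8)) * D := by
    intro x
    have hc : (8/7 : ℝ).HolderConjugate 8 := by
      rw [Real.holderConjugate_iff]; norm_num
    have hol := ENNReal.lintegral_mul_le_Lp_mul_Lq volume hc (f := fun y => Kd δ (x - y))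
      (g := jb (-1/5)) (by fun_prop) (by fun_prop)
    calc ∫⁻ y, Kd δ (x - y) * jb (2/5 - b) y ^ 2 ≤ ∫⁻ y, Kd δ (x - y) * jb (-1/5) y := by
          gcongr with y
          rw [jb_sq]; apply jb_mono; linarith
      _ ≤ _ := hol
      _ ≤ (ENNReal.ofReal (δ ^ ((1:ℝ)/7)) * C2) ^ ((7:ℝ)/8) *
            (∫⁻ y, jb (-8/5) y) ^ ((1:ℝ)/8) := by
          gcongr ?_ * ?_
          · rw [show (1 / (8/7) : ℝ) = 7/8 by norm_num]
            gcongr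
            rw [lintegral_sub_left_eq_self (fun z => Kd δ z ^ (8/7:ℝ)) x]
            have : ∀ z, Kd δ z ^ (8/7:ℝ) ≤ ENNReal.ofReal (δ ^ ((1:ℝ)/7)) * Kd δ z := by
              intro z
              unfold Kd
              rw [ENNReal.mul_rpow_of_nonneg _ _ (by norm_num), jb_rpow _ _ (by norm_num),
                ENNReal.ofReal_rpow_of_nonneg hδ.le (by norm_num), ← mul_assoc,
                ← ENNReal.ofReal_mul (by positivity), ← Real.rpow_add_one hδ.ne']
              refine mul_le_mul' ?_ (jb_mono (by norm_num) _)
              apply le_of_eq; norm_num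
            refine (lintegral_mono this).trans ?_
            rw [lintegral_const_mul _ hKm, Kd_int hδ]
          · apply le_of_eq
            congr 2; ext y
            rw [jb_rpow _ _ (by norm_num)]; norm_num
      _ = _ := by
          rw [ENNReal.mul_rpow_of_nonneg _ _ (by norm_num), hD,
            ENNReal.ofReal_rpow_of_nonneg (by positivity) (by norm_num), ← Real.rpow_mul hδ.le]
          norm_num [mul_assoc]
  have := prod_est (s := 2/5) (b := b) (δ := δ) (by norm_num) (by norm_num) hδ hδ1 ha hB
  rw [show (2 * (2/5) : ℝ) = 4/5 by norm_num] at this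
  refine this.trans ?_
  gcongr ?_ * _
  have h1 : ENNReal.ofReal (δ ^ (1 - 4/5 : ℝ)) ≤ ENNReal.ofReal (δ ^ ((1:ℝ)/8)) := by
    apply ENNReal.ofReal_le_ofReal
    exact Real.rpow_le_rpow_of_exponent_ge hδ hδ1.le (by norm_num)
  calc _ ≤ 2 * C2 * (ENNReal.ofReal (δ ^ ((1:ℝ)/8)) * (∫⁻ y, jb (-2 * b) y) +
        ENNReal.ofReal (δ ^ ((1:ℝ)/8)) * D) := by
        gcongr
    _ = _ := by ring

/-- Duhamel-type kernel estimate. -/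
lemma duh_est {b : ℝ} (hb : 1/2 < b) (hb1 : b < 1) : ∃ C : ℝ≥0∞, C < ∞ ∧
    ∀ δ : ℝ, 0 < δ → δ < 1 → ∀ f : ℝ → ℝ≥0∞, Measurable f →
    ∫⁻ x, jb (2 * b) x * (∫⁻ y, (Kd δ (x - y) + Kd δ x) * (jb (-1) y * f y)) ^ 2 ≤
      C * ENNReal.ofReal (δ ^ (1 - 2 * b)) * ∫⁻ y, jb (2 * b - 2) y * f y ^ 2 := by
  obtain ⟨C, hC, hCe⟩ := prod_est_b hb hb1
  have hfin : ∫⁻ y, jb (-2 * b) y < ∞ := jb_int (by linarith)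
  refine ⟨2 * (C + C2 * ∫⁻ y, jb (-2 * b) y), ?_, ?_⟩
  · exact ENNReal.mul_lt_top (by simp) (ENNReal.add_lt_top.2 ⟨hC, ENNReal.mul_lt_top C2_lt hfin⟩)
  intro δ hδ hδ1 f hf
  have hKm := Kd_meas δ
  have hj1 := jb_meas (-1)
  have hj2 := jb_meas b
  have hj3 := jb_meas (-b)
  have hj4 := jb_meas (2 * b)
  set a := fun y => jb (-1) y * f y with hadef
  have ha : Measurable a := by fun_prop
  have hE : ∫⁻ y, jb (2 * b) y * a y ^ 2 = ∫⁻ y, jb (2 * b - 2) y * f y ^ 2 := by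
    congr 1; ext y
    simp only [hadef, mul_pow, jb_sq, ← mul_assoc, jb_mul]
    congr 2; ring
  have hL1 : (∫⁻ y, a y) ^ 2 ≤ (∫⁻ y, jb (-2 * b) y) * ∫⁻ y, jb (2 * b) y * a y ^ 2 := by
    have := cs_sq volume (f := fun y => jb (-b) y) (g := fun y => jb b y * a y)
      (by fun_prop) (by fun_prop)
    simp only [mul_pow, jb_sq, ← mul_assoc, jb_mul, neg_add_cancel, jb_zero, one_mul] at this
    simpa using this
  have hm : Measurable fun x => (∫⁻ y, Kd δ (x - y) * a y) := by
    apply Measurable.lintegral_prod_right' (f := fun q : ℝ × ℝ => Kd δ (q.1 - q.2) * a q.2)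
    fun_prop
  have hpt : ∀ x, jb (2 * b) x * (∫⁻ y, (Kd δ (x - y) + Kd δ x) * a y) ^ 2 ≤
      2 * (jb (2 * b) x * (∫⁻ y, Kd δ (x - y) * a y) ^ 2) +
      2 * ((jb b x * Kd δ x) ^ 2 * (∫⁻ y, a y) ^ 2) := by
    intro x
    simp only [add_mul]
    rw [lintegral_add_left (by fun_prop), lintegral_const_mul _ ha]
    refine (mul_le_mul_right (sq_add_le _ _) _).trans (le_of_eq ?_)
    rw [mul_pow (jb b x), jb_sq]; ring
  refine (lintegral_mono hpt).trans ?_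
  rw [lintegral_add_left (by fun_prop), lintegral_const_mul _ (by fun_prop),
    lintegral_const_mul _ (by fun_prop), lintegral_mul_const _ (by fun_prop)]
  have t1 := hCe δ hδ hδ1 a ha
  have t2 := Kd_sq_int (s := b) (by linarith) hb1.le hδ hδ1
  rw [← hE]
  calc _ ≤ 2 * (C * ENNReal.ofReal (δ ^ (1 - 2 * b)) * ∫⁻ y, jb (2 * b) y * a y ^ 2) +
      2 * ((ENNReal.ofReal (δ ^ (1 - 2 * b)) * C2) *
        ((∫⁻ y, jb (-2 * b) y) * ∫⁻ y, jb (2 * b) y * a y ^ 2)) := by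
        gcongr
    _ = _ := by ring

end kernels


section kernelSum
open scoped ENNReal

/-- The measure on `ℤ × ℝ`. -/
noncomputable abbrev stM : Measure (ℤ × ℝ) := (Measure.count : Measure ℤ).prod volume

/-- spacetime weight -/
noncomputable def jw (p : ℝ) (z : ℤ × ℝ) : ℝ≥0∞ := jb p (z.2 + 2 * Real.pi * (z.1 : ℝ) ^ 2)

lemma int_fn_meas {β : Type*} [MeasurableSpace β] (f : ℤ → β) : Measurable f :=
  measurable_from_top

lemma jw_meas (p : ℝ) : Measurable (jw p) := by
  unfold jw
  have h : Measurable (fun z : ℤ × ℝ => (z.1 : ℝ)) := (int_fn_meas _).comp measurable_fst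
  exact (jb_meas p).comp (by fun_prop)

lemma lintegral_stM {f : ℤ × ℝ → ℝ≥0∞} (hf : Measurable f) :
    ∫⁻ z, f z ∂stM = ∑' k : ℤ, ∫⁻ η, f (k, η) := by
  rw [lintegral_prod _ hf.aemeasurable, lintegral_count]

lemma jb_conv_pt (c x : ℝ) : jb (-4/5) x * jb (-4/5) (c - x) ≤
    ENNReal.ofReal (2 ^ (11/20 : ℝ)) * jb (-11/20) c * (jb (-21/20) x + jb (-21/20) (c - x)) := by
  have main : ∀ u v C : ℝ, 1 ≤ u → u ≤ v → 1 ≤ C → C ≤ 2 * v →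
      u ^ (-4/5 : ℝ) * v ^ (-4/5 : ℝ) ≤ 2 ^ (11/20 : ℝ) * C ^ (-11/20 : ℝ) * u ^ (-21/20 : ℝ) := by
    intro u v C hu huv hC hCv
    have hu0 : 0 < u := by linarith
    have hv0 : 0 < v := by linarith
    calc u ^ (-4/5 : ℝ) * v ^ (-4/5 : ℝ)
        = u ^ (-4/5 : ℝ) * (v ^ (-1/4 : ℝ) * v ^ (-11/20 : ℝ)) := by
          rw [← Real.rpow_add hv0]; norm_num
      _ ≤ u ^ (-4/5 : ℝ) * (u ^ (-1/4 : ℝ) * (C / 2) ^ (-11/20 : ℝ)) := by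
          gcongr u ^ (-4/5 : ℝ) * (?_ * ?_)
          · exact Real.rpow_le_rpow_of_nonpos hu0 huv (by norm_num)
          · exact Real.rpow_le_rpow_of_nonpos (by linarith) (by linarith) (by norm_num)
      _ = (C / 2) ^ (-11/20 : ℝ) * (u ^ (-4/5 : ℝ) * u ^ (-1/4 : ℝ)) := by ring
      _ = (C / 2) ^ (-11/20 : ℝ) * u ^ (-21/20 : ℝ) := by
          rw [← Real.rpow_add hu0]; norm_num
      _ = _ := by
          rw [Real.div_rpow (by linarith) (by norm_num), show (-11/20 : ℝ) = -(11/20) by norm_num,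
            Real.rpow_neg (by norm_num : (0:ℝ) ≤ 2)]
          field_simp
  unfold jb
  have htri : |c| ≤ |x| + |c - x| := by
    have := abs_add_le x (c - x); simpa using this
  have hx := abs_nonneg x
  have hcx := abs_nonneg (c - x)
  have hc := abs_nonneg c
  rw [← ENNReal.ofReal_mul (by positivity), ← ENNReal.ofReal_mul (by positivity),
    ← ENNReal.ofReal_add (by positivity) (by positivity), ← ENNReal.ofReal_mul (by positivity)]
  apply ENNReal.ofReal_le_ofReal
  rcases le_total |x| |c - x| with h | h
  · refine (main (1 + |x|) (1 + |c - x|) (1 + |c|) (by linarith) (by linarith) (by linarith)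
      (by linarith)).trans ?_
    gcongr
    exact le_add_of_nonneg_right (by positivity)
  · rw [mul_comm ((1 + |x|) ^ (-4/5 : ℝ))]
    refine (main (1 + |c - x|) (1 + |x|) (1 + |c|) (by linarith) (by linarith) (by linarith)
      (by linarith)).trans ?_
    gcongr
    exact le_add_of_nonneg_left (by positivity)

lemma jb_conv : ∃ C : ℝ≥0∞, C < ∞ ∧ ∀ c : ℝ,
    ∫⁻ x, jb (-4/5) x * jb (-4/5) (c - x) ≤ C * jb (-11/20) c := by
  have hf : ∫⁻ x, jb (-21/20) x < ∞ := jb_int (by norm_num)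
  refine ⟨ENNReal.ofReal (2 ^ (11/20 : ℝ)) * ((∫⁻ x, jb (-21/20) x) + (∫⁻ x, jb (-21/20) x)), ?_, ?_⟩
  · exact ENNReal.mul_lt_top (by simp) (ENNReal.add_lt_top.2 ⟨hf, hf⟩)
  intro c
  refine (lintegral_mono (jb_conv_pt c)).trans ?_
  have hm := jb_meas (-21/20)
  rw [lintegral_const_mul _ (by fun_prop), lintegral_add_left (by fun_prop),
    lintegral_sub_left_eq_self (jb (-21/20)) c]
  apply le_of_eq; ring

lemma sum_shift : ∃ C : ℝ≥0∞, C < ∞ ∧ ∀ M : ℝ,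
    ∑' m : ℤ, ENNReal.ofReal ((1 + ((m : ℝ) - M) ^ 2) ^ (-11/20 : ℝ)) ≤ C := by
  have hsum : Summable fun m : ℤ => (3:ℝ) ^ (11/20 : ℝ) * (1 + (m:ℝ) ^ 2) ^ (-11/20 : ℝ) := by
    apply Summable.mul_left
    have h := Real.summable_abs_int_rpow (b := 11/10) (by norm_num)
    refine Summable.of_norm_bounded_eventually h ?_
    rw [Filter.eventually_cofinite]
    refine (Set.finite_singleton (0:ℤ)).subset ?_
    intro m hm
    by_contra hm0
    apply hm
    have hm0' : m ≠ 0 := hm0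
    have hpos : 0 < |(m:ℝ)| := by positivity
    rw [Real.norm_of_nonneg (by positivity)]
    calc (1 + (m:ℝ) ^ 2) ^ (-11/20 : ℝ) ≤ (|(m:ℝ)| ^ (2:ℝ)) ^ (-11/20 : ℝ) := by
          apply Real.rpow_le_rpow_of_nonpos (by positivity) _ (by norm_num)
          rw [Real.rpow_two, sq_abs]; linarith
      _ = _ := by rw [← Real.rpow_mul hpos.le]; norm_num
  refine ⟨∑' m : ℤ, ENNReal.ofReal ((3:ℝ) ^ (11/20 : ℝ) * (1 + (m:ℝ) ^ 2) ^ (-11/20 : ℝ)), ?_, ?_⟩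
  · exact hsum.tsum_ofReal_lt_top
  intro M
  rw [← (Equiv.addRight ⌊M⌋).tsum_eq]
  apply ENNReal.tsum_le_tsum
  intro m
  apply ENNReal.ofReal_le_ofReal
  simp only [Equiv.coe_addRight]
  push_cast
  set r := M - ⌊M⌋ with hr
  have hr0 : 0 ≤ r := by have := Int.floor_le M; linarith
  have hr1 : r ≤ 1 := by have := Int.lt_floor_add_one M; linarith
  have e : (m:ℝ) + ⌊M⌋ - M = m - r := by rw [hr]; ring
  rw [e]
  have h3 : (1 + (m:ℝ)^2) / 3 ≤ 1 + ((m:ℝ) - r) ^ 2 := by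
    nlinarith [sq_nonneg ((m:ℝ) - 2 * r), sq_nonneg ((m:ℝ) - r)]
  calc (1 + ((m:ℝ) - r) ^ 2) ^ (-11/20 : ℝ) ≤ ((1 + (m:ℝ)^2) / 3) ^ (-11/20 : ℝ) :=
        Real.rpow_le_rpow_of_nonpos (by positivity) h3 (by norm_num)
    _ = _ := by
        rw [Real.div_rpow (by positivity) (by norm_num), show (-11/20 : ℝ) = -(11/20) by norm_num,
            Real.rpow_neg (by norm_num : (0:ℝ) ≤ 3)]
        field_simp

lemma sum_quad : ∃ C : ℝ≥0∞, C < ∞ ∧ ∀ A : ℝ,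
    ∑' m : ℤ, jb (-11/20) (A + Real.pi * (m:ℝ) ^ 2) ≤ C := by
  obtain ⟨C, hC, h⟩ := sum_shift
  refine ⟨C + C, ENNReal.add_lt_top.2 ⟨hC, hC⟩, ?_⟩
  intro A
  set M := Real.sqrt (max (-A / Real.pi) 0) with hM
  have hMA : ∀ m : ℤ, (|(m:ℝ)| - M) ^ 2 ≤ |A + Real.pi * (m:ℝ)^2| := by
    intro m
    have hpi := Real.pi_gt_three
    have hM0 : 0 ≤ M := Real.sqrt_nonneg _
    have hM2 : M ^ 2 = max (-A / Real.pi) 0 := Real.sq_sqrt (le_max_right _ _)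
    have hm0 := abs_nonneg (m:ℝ)
    rcases le_total 0 A with hA | hA
    · have : M ^ 2 = 0 := by
        rw [hM2, max_eq_right]; rw [neg_div]; have : 0 ≤ A / Real.pi := by positivity
        linarith
      have hM00 : M = 0 := by simpa using this
      rw [hM00, sub_zero, sq_abs, abs_of_nonneg (by positivity)]
      nlinarith [sq_nonneg (m:ℝ)]
    · have hA2 : A = - Real.pi * M ^ 2 := by
        rw [hM2, max_eq_left]
        · field_simp
        · apply div_nonneg <;> linarith
      rw [hA2, ← sq_abs (m:ℝ)]
      rw [show -Real.pi * M^2 + Real.pi * |(m:ℝ)|^2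
        = Real.pi * ((|(m:ℝ)| - M) * (|(m:ℝ)| + M)) by ring, abs_mul, abs_mul,
        abs_of_pos Real.pi_pos, abs_of_nonneg (add_nonneg hm0 hM0), ← sq_abs (|(m:ℝ)| - M), pow_two]
      have h1 : |(|(m:ℝ)| - M)| ≤ |(m:ℝ)| + M := by rw [abs_le]; constructor <;> linarith
      have h2 := abs_nonneg (|(m:ℝ)| - M)
      nlinarith [mul_nonneg h2 (add_nonneg hm0 hM0), mul_le_mul_of_nonneg_left h1 h2]
  have hpt : ∀ m : ℤ, jb (-11/20) (A + Real.pi * (m:ℝ) ^ 2) ≤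
      ENNReal.ofReal ((1 + ((m : ℝ) - M) ^ 2) ^ (-11/20 : ℝ)) +
      ENNReal.ofReal ((1 + ((m : ℝ) - (-M)) ^ 2) ^ (-11/20 : ℝ)) := by
    intro m
    have h1 : jb (-11/20) (A + Real.pi * (m:ℝ) ^ 2) ≤
        ENNReal.ofReal ((1 + (|(m:ℝ)| - M) ^ 2) ^ (-11/20 : ℝ)) := by
      unfold jb
      apply ENNReal.ofReal_le_ofReal
      apply Real.rpow_le_rpow_of_nonpos (by positivity) _ (by norm_num)
      linarith [hMA m]
    refine h1.trans ?_
    rcases abs_choice (m:ℝ) with h2 | h2 <;> rw [h2]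
    · exact le_self_add
    · rw [show (-(m:ℝ) - M) ^ 2 = ((m:ℝ) - (-M)) ^ 2 by ring]; exact le_add_self
  refine (ENNReal.tsum_le_tsum hpt).trans ?_
  rw [ENNReal.tsum_add]
  exact add_le_add (h M) (h (-M))

/-- The key kernel bound (Bourgain's `L⁴` Strichartz estimate with `s = 2/5`). -/
lemma kernel_bound : ∃ M : ℝ≥0∞, M < ∞ ∧ ∀ z : ℤ × ℝ,
    ∫⁻ y, jw (-4/5) y * jw (-4/5) (z - y) ∂stM ≤ M := by
  obtain ⟨C1, hC1, h1⟩ := jb_conv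
  obtain ⟨C2, hC2, h2⟩ := sum_quad
  refine ⟨C1 * C2, ENNReal.mul_lt_top hC1 hC2, ?_⟩
  rintro ⟨k, η⟩
  have hm := jw_meas (-4/5)
  rw [lintegral_stM (by fun_prop)]
  have hin : ∀ j : ℤ, ∫⁻ ζ, jw (-4/5) (j, ζ) * jw (-4/5) ((k, η) - (j, ζ)) ≤
      C1 * jb (-11/20) ((η + Real.pi * (k:ℝ)^2) + Real.pi * ((2 * j - k : ℤ) : ℝ) ^ 2) := by
    intro j
    have := h1 ((η + Real.pi * (k:ℝ)^2) + Real.pi * ((2 * j - k : ℤ) : ℝ) ^ 2)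
    refine le_trans (le_of_eq ?_) this
    refine Eq.trans ?_ (lintegral_add_right_eq_self _ (2 * Real.pi * (j:ℝ)^2))
    congr 1; ext ζ
    simp only [jw, Prod.mk_sub_mk]
    congr 2
    push_cast; ring
  refine (ENNReal.tsum_le_tsum hin).trans ?_
  rw [ENNReal.tsum_mul_left]
  gcongr
  refine le_trans ?_ (h2 (η + Real.pi * (k:ℝ)^2))
  exact ENNReal.tsum_comp_le_tsum_of_injective (f := fun j : ℤ => 2 * j - k)
    (fun a c h => by simp only at h; omega)
    (fun m : ℤ => jb (-11/20) ((η + Real.pi * (k:ℝ)^2) + Real.pi * (m:ℝ)^2))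

end kernelSum


section fourierBasics
open scoped ENNReal

/-- `e^{2πia}` -/
noncomputable def ex (a : ℝ) : ℂ := Complex.exp (2 * Real.pi * Complex.I * a)

lemma ex_add (a c : ℝ) : ex (a + c) = ex a * ex c := by
  unfold ex; rw [← Complex.exp_add]; congr 1; push_cast; ring

lemma ex_norm (a : ℝ) : ‖ex a‖ = 1 := by
  unfold ex
  rw [show (2 * Real.pi * Complex.I * a : ℂ) = ((2 * Real.pi * a : ℝ) : ℂ) * Complex.I by
    push_cast; ring]
  exact Complex.norm_exp_ofReal_mul_I _

lemma ex_enorm (a : ℝ) : ‖ex a‖ₑ = 1 := by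
  rw [← ofReal_norm, ex_norm]; simp

lemma ex_zero : ex 0 = 1 := by simp [ex]

lemma ex_int (k : ℤ) : ex k = 1 := by
  unfold ex
  rw [show (2 * Real.pi * Complex.I * ((k:ℝ):ℂ) : ℂ) = k * (2 * Real.pi * Complex.I) by
    push_cast; ring]
  exact Complex.exp_int_mul_two_pi_mul_I k

lemma ex_cont : Continuous ex := by unfold ex; fun_prop

lemma ex_meas : Measurable ex := ex_cont.measurable

lemma ex_hasDerivAt (c d t : ℝ) :
    HasDerivAt (fun s : ℝ => ex (c * s + d)) (2 * Real.pi * Complex.I * c * ex (c * t + d)) t := by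
  unfold ex
  have h1 : HasDerivAt (fun s : ℝ => ((c * s + d : ℝ) : ℂ)) (c : ℂ) t := by
    have : HasDerivAt (fun s : ℝ => c * s + d) c t := by
      simpa using ((hasDerivAt_id t).const_mul c).add_const d
    exact this.ofReal_comp
  have := (h1.const_mul (2 * Real.pi * Complex.I)).cexp
  convert! this using 1
  ring

lemma torusCoeff_eq (Φ : ℝ → ℂ) (k : ℤ) :
    torusCoeff Φ k = ∫ x in (0:ℝ)..1, Φ x * ex (-(k * x)) := by
  unfold torusCoeff ex
  congr 1; ext x; congr 2; push_cast; ring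

lemma stFT_eq (f : ℝ → ℝ → ℂ) (k : ℤ) (η : ℝ) :
    stFT f k η = ∫ t : ℝ, ∫ x in (0:ℝ)..1, f x t * ex (-(k * x + η * t)) := by
  unfold stFT ex
  congr 1; ext t; congr 1; ext x; congr 2; push_cast; ring

lemma stFT_eq_torus (f : ℝ → ℝ → ℂ) (k : ℤ) (η : ℝ) :
    stFT f k η = ∫ t : ℝ, torusCoeff (fun x => f x t) k * ex (-(η * t)) := by
  rw [stFT_eq]
  congr 1; ext t
  rw [torusCoeff_eq, ← intervalIntegral.integral_mul_const]
  congr 1; ext x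
  rw [neg_add, ex_add]; ring

/-- The measure on `(0,1] × ℝ`. -/
noncomputable abbrev nuM : Measure (ℝ × ℝ) :=
  ((volume : Measure ℝ).restrict (Set.Ioc 0 1)).prod volume

lemma integrable_nuM {F : ℝ × ℝ → ℂ} (hF : Continuous F) {T : ℝ}
    (hT : ∀ x t, T ≤ |t| → F (x, t) = 0) : Integrable F nuM := by
  have h1 : IntegrableOn F (Set.Icc (0:ℝ) 1 ×ˢ Set.Icc (-T) T) (volume.prod volume) :=
    (hF.continuousOn).integrableOn_compact (isCompact_Icc.prod isCompact_Icc)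
  have h2 : IntegrableOn F (Set.Ioc (0:ℝ) 1 ×ˢ Set.Icc (-T) T) (volume.prod volume) :=
    h1.mono_set (Set.prod_mono Set.Ioc_subset_Icc_self le_rfl)
  have h3 : nuM = (volume.prod volume).restrict (Set.Ioc (0:ℝ) 1 ×ˢ (Set.univ : Set ℝ)) := by
    rw [← Measure.prod_restrict, Measure.restrict_univ]
  rw [h3]
  refine IntegrableOn.of_forall_sdiff_eq_zero h2 (measurableSet_Ioc.prod MeasurableSet.univ) ?_
  rintro ⟨x, t⟩ ⟨⟨hx, -⟩, hn⟩
  apply hT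
  by_contra hlt
  push Not at hlt
  exact hn ⟨hx, abs_le.1 hlt.le⟩

variable {f h : ℝ → ℝ → ℂ}

lemma SmoothCptTime.cont (hf : SmoothCptTime f) : Continuous (fun p : ℝ × ℝ => f p.1 p.2) :=
  hf.1.continuous

lemma SmoothCptTime.integrable (hf : SmoothCptTime f) {e : ℝ × ℝ → ℂ} (he : Continuous e) :
    Integrable (fun p : ℝ × ℝ => f p.1 p.2 * e p) nuM := by
  obtain ⟨T, hT⟩ := hf.2.2
  exact integrable_nuM (hf.cont.mul he) (T := T) (fun x t ht => by simp [hT x t ht])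

lemma stFT_nuM (hf : SmoothCptTime f) (k : ℤ) (η : ℝ) :
    stFT f k η = ∫ p, f p.1 p.2 * ex (-(k * p.1 + η * p.2)) ∂nuM := by
  rw [stFT_eq, integral_prod_symm]
  · congr 1; ext t
    rw [intervalIntegral.integral_of_le zero_le_one]
  · exact hf.integrable (ex_cont.comp (by fun_prop))

lemma SmoothCptTime.mul (hf : SmoothCptTime f) (hh : SmoothCptTime h) :
    SmoothCptTime (fun x t => f x t * h x t) := by
  obtain ⟨T, hT⟩ := hf.2.2
  exact ⟨hf.1.mul hh.1, fun x t => by simp only [hf.2.1, hh.2.1], T, fun x t ht => by simp [hT x t ht]⟩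

lemma SmoothCptTime.conj (hf : SmoothCptTime f) :
    SmoothCptTime (fun x t => (starRingEnd ℂ) (f x t)) := by
  obtain ⟨T, hT⟩ := hf.2.2
  refine ⟨?_, fun x t => by simp only [hf.2.1], T, fun x t ht => by simp [hT x t ht]⟩
  exact Complex.conjCLE.contDiff.comp hf.1

lemma SmoothCptTime.timeMul (hf : SmoothCptTime f) {ψ : ℝ → ℂ} (hψ : ContDiff ℝ (⊤ : ℕ∞) ψ)
    (δ : ℝ) : SmoothCptTime (fun x t => ψ (t / δ) * f x t) := by
  obtain ⟨T, hT⟩ := hf.2.2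
  refine ⟨?_, fun x t => by simp only [hf.2.1], T, fun x t ht => by simp [hT x t ht]⟩
  exact (hψ.comp (contDiff_snd.div_const δ)).mul hf.1

/-- directional derivative -/
noncomputable def opD (v : ℝ × ℝ) (f : ℝ → ℝ → ℂ) : ℝ → ℝ → ℂ :=
  fun x t => fderiv ℝ (fun p : ℝ × ℝ => f p.1 p.2) (x, t) v

lemma SmoothCptTime.opD (hf : SmoothCptTime f) (v : ℝ × ℝ) : SmoothCptTime (opD v f) := by
  obtain ⟨T, hT⟩ := hf.2.2
  refine ⟨?_, ?_, T + 1, ?_⟩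
  · have : ContDiff ℝ (⊤ : ℕ∞) (fun p : ℝ × ℝ => fderiv ℝ (fun p : ℝ × ℝ => f p.1 p.2) p v) :=
      (hf.1.fderiv_right (m := (⊤ : ℕ∞)) (by simp)).clm_apply contDiff_const
    exact this
  · intro x t
    unfold _root_.opD
    have h0 := fderiv_comp_add_right (𝕜 := ℝ) (f := fun p : ℝ × ℝ => f p.1 p.2) (x := (x, t))
      ((1:ℝ), (0:ℝ))
    have h1 : (fun p : ℝ × ℝ => f (p + ((1:ℝ), (0:ℝ))).1 (p + ((1:ℝ), (0:ℝ))).2) =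
        fun p : ℝ × ℝ => f p.1 p.2 := by
      ext p; simp [hf.2.1]
    rw [h1] at h0
    rw [h0]
    simp
  · intro x t ht
    unfold _root_.opD
    have : (fun p : ℝ × ℝ => f p.1 p.2) =ᶠ[nhds (x, t)] fun _ => 0 := by
      have ho : IsOpen {p : ℝ × ℝ | T < |p.2|} := isOpen_lt continuous_const (by fun_prop)
      filter_upwards [ho.mem_nhds (show (x, t) ∈ {p : ℝ × ℝ | T < |p.2|} by
        simp only [Set.mem_ofPred_eq]; linarith)] with p hp
      exact hT _ _ (le_of_lt hp)
    rw [this.fderiv_eq]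
    simp

lemma opD_t (hf : SmoothCptTime f) (x t : ℝ) :
    HasDerivAt (fun s => f x s) (opD (0, 1) f x t) t := by
  have h1 : HasFDerivAt (fun p : ℝ × ℝ => f p.1 p.2) _ (x, t) :=
    (hf.1.differentiable (by simp) (x, t)).hasFDerivAt
  have h2 : HasDerivAt (fun s : ℝ => (x, s)) ((0:ℝ), (1:ℝ)) t :=
    (hasDerivAt_const t x).prodMk (hasDerivAt_id t)
  exact h1.comp_hasDerivAt t h2

lemma opD_x (hf : SmoothCptTime f) (x t : ℝ) :
    HasDerivAt (fun y => f y t) (opD (1, 0) f x t) x := by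
  have h1 : HasFDerivAt (fun p : ℝ × ℝ => f p.1 p.2) _ (x, t) :=
    (hf.1.differentiable (by simp) (x, t)).hasFDerivAt
  have h2 : HasDerivAt (fun s : ℝ => (s, t)) ((1:ℝ), (0:ℝ)) x :=
    (hasDerivAt_id x).prodMk (hasDerivAt_const x t)
  exact h1.comp_hasDerivAt x h2

lemma stFT_opD_t (hf : SmoothCptTime f) (k : ℤ) (η : ℝ) :
    stFT (opD (0, 1) f) k η = (2 * Real.pi * Complex.I * η) * stFT f k η := by
  have he : Continuous fun p : ℝ × ℝ => ex (-(k * p.1 + η * p.2)) := ex_cont.comp (by fun_prop)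
  have i1 := (hf.opD (0,1)).integrable he
  have i2 := (hf.integrable he).const_mul (2 * Real.pi * Complex.I * η)
  have i3 : Integrable (fun p : ℝ × ℝ => opD (0, 1) f p.1 p.2 * ex (-(k * p.1 + η * p.2)) -
      2 * Real.pi * Complex.I * η * (f p.1 p.2 * ex (-(k * p.1 + η * p.2)))) nuM := i1.sub i2
  rw [stFT_nuM (hf.opD _), stFT_nuM hf, ← sub_eq_zero, ← integral_const_mul, ← integral_sub i1 i2,
    integral_prod _ i3]
  have hz : ∀ x : ℝ, ∫ t : ℝ, (opD (0, 1) f x t * ex (-(k * x + η * t)) -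
      2 * Real.pi * Complex.I * η * (f x t * ex (-(k * x + η * t)))) = 0 := by
    intro x
    obtain ⟨T, hT⟩ := hf.2.2
    have hcs : ∀ g : ℝ → ℂ, Continuous g → ∀ T : ℝ, (∀ t, T ≤ |t| → g t = 0) → Integrable g := by
      intro g hg T hT
      refine hg.integrable_of_hasCompactSupport ?_
      refine HasCompactSupport.intro (isCompact_Icc (a := -T) (b := T)) ?_
      intro t ht
      apply hT
      by_contra hlt
      push Not at hlt
      exact ht (abs_le.1 hlt.le)
    have hex : Continuous fun t : ℝ => ex (-(k * x + η * t)) := ex_cont.comp (by fun_prop)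
    have hfx : Continuous fun t : ℝ => f x t := hf.cont.comp (by fun_prop : Continuous fun t : ℝ => (x, t))
    have hgx : Continuous fun t : ℝ => opD (0,1) f x t :=
      (hf.opD (0,1)).cont.comp (by fun_prop : Continuous fun t : ℝ => (x, t))
    obtain ⟨T', hT'⟩ := (hf.opD (0,1)).2.2
    have j1 : Integrable fun t : ℝ => f x t * ex (-(k * x + η * t)) :=
      hcs _ (hfx.mul hex) T (fun t ht => by simp [hT x t ht])
    have j2 : Integrable fun t : ℝ => opD (0,1) f x t * ex (-(k * x + η * t)) :=
      hcs _ (hgx.mul hex) T' (fun t ht => by simp [hT' x t ht])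
    refine integral_eq_zero_of_hasDerivAt_of_integrable (f := fun t => f x t * ex (-(k * x + η * t)))
      ?_ (j2.sub (j1.const_mul _)) j1
    intro t
    have h1 := opD_t hf x t
    have h2 := ex_hasDerivAt (-η) (-(k*x)) t
    have h3 := h1.mul h2
    have e : (fun t : ℝ => f x t * ex (-(k * x + η * t))) =
        (fun s => f x s) * fun s => ex (-η * s + -(k * x)) := by
      ext s; simp only [Pi.mul_apply]; congr 2; ring
    rw [e]
    convert! h3 using 1
    rw [show -η * t + -(k*x) = -(k * x + η * t) by ring]
    push_cast; ring
  simp only [hz]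
  simp

lemma torusCoeff_opD_x (hf : SmoothCptTime f) (k : ℤ) (t : ℝ) :
    torusCoeff (fun x => opD (1, 0) f x t) k
      = (2 * Real.pi * Complex.I * k) * torusCoeff (fun x => f x t) k := by
  have hex : Continuous fun x : ℝ => ex (-(k * x)) := ex_cont.comp (by fun_prop)
  have hfx : Continuous fun x : ℝ => f x t := hf.cont.comp (by fun_prop : Continuous fun x : ℝ => (x, t))
  have hgx : Continuous fun x : ℝ => opD (1,0) f x t :=
    (hf.opD (1,0)).cont.comp (by fun_prop : Continuous fun x : ℝ => (x, t))
  have i1 : IntervalIntegrable (fun x => opD (1, 0) f x t * ex (-(k * x))) volume 0 1 :=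
    (hgx.mul hex).intervalIntegrable _ _
  have i2 : IntervalIntegrable (fun x => 2 * Real.pi * Complex.I * k * (f x t * ex (-(k * x))))
      volume 0 1 := ((hfx.mul hex).const_mul _).intervalIntegrable _ _
  rw [torusCoeff_eq, torusCoeff_eq, ← sub_eq_zero, ← intervalIntegral.integral_const_mul,
    ← intervalIntegral.integral_sub i1 i2]
  have := intervalIntegral.integral_eq_sub_of_hasDerivAt (a := 0) (b := 1)
    (f := fun x => f x t * ex (-(k * x))) (f' := fun x => opD (1, 0) f x t * ex (-(k * x)) -
      2 * Real.pi * Complex.I * k * (f x t * ex (-(k * x)))) (by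
    intro x _
    have h1 := opD_x hf x t
    have h2 := ex_hasDerivAt (-k) 0 x
    have h3 := h1.mul h2
    have e : (fun x : ℝ => f x t * ex (-(k * x))) =
        (fun s => f s t) * fun s => ex (-k * s + 0) := by
      ext s; simp only [Pi.mul_apply]; congr 2; ring
    rw [e]
    convert! h3 using 1
    rw [show -k * x + 0 = -(k * x) by ring]
    push_cast; ring) (Continuous.intervalIntegrable (by fun_prop) _ _)
  rw [this]
  have h1 : f 1 t = f 0 t := by simpa using hf.2.1 0 t
  have h2 : ex (-(k * 1)) = 1 := by simpa using ex_int (-k)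
  rw [h1, h2]
  simp [ex_zero]

lemma stFT_opD_x (hf : SmoothCptTime f) (k : ℤ) (η : ℝ) :
    stFT (opD (1, 0) f) k η = (2 * Real.pi * Complex.I * k) * stFT f k η := by
  rw [stFT_eq_torus, stFT_eq_torus, ← integral_const_mul]
  congr 1; ext t
  rw [torusCoeff_opD_x hf]; ring

lemma stFT_bdd (hf : SmoothCptTime f) : ∃ C : ℝ, 0 ≤ C ∧ ∀ k η, ‖stFT f k η‖ ≤ C := by
  refine ⟨∫ p, ‖f p.1 p.2‖ ∂nuM, integral_nonneg (fun _ => norm_nonneg _), ?_⟩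
  intro k η
  rw [stFT_nuM hf]
  refine (norm_integral_le_integral_norm _).trans (le_of_eq ?_)
  congr 1; ext p
  rw [norm_mul, ex_norm, mul_one]

lemma stFT_decay (hf : SmoothCptTime f) : ∃ C : ℝ, 0 ≤ C ∧ ∀ (k : ℤ) (η : ℝ),
    ‖stFT f k η‖ ≤ C * (1 + (k:ℝ) ^ 2)⁻¹ * (1 + η ^ 2)⁻¹ := by
  have h1 := hf.opD (1, 0)
  have h2 := h1.opD (1, 0)
  have h3 := hf.opD (0, 1)
  have h4 := h3.opD (0, 1)
  have h5 := h4.opD (1, 0)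
  have h6 := h5.opD (1, 0)
  obtain ⟨C0, hC0, b0⟩ := stFT_bdd hf
  obtain ⟨C1, hC1, b1⟩ := stFT_bdd h2
  obtain ⟨C2, hC2, b2⟩ := stFT_bdd h4
  obtain ⟨C3, hC3, b3⟩ := stFT_bdd h6
  refine ⟨C0 + C1 + C2 + C3, by positivity, ?_⟩
  intro k η
  have hpi : 1 ≤ 2 * Real.pi := by linarith [Real.pi_gt_three]
  set X := ‖stFT f k η‖ with hX
  have hX0 : 0 ≤ X := norm_nonneg _
  have c0 := b0 k η
  have c1 := b1 k η
  have c2 := b2 k η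
  have c3 := b3 k η
  rw [stFT_opD_x h1, stFT_opD_x hf] at c1
  rw [stFT_opD_t h3, stFT_opD_t hf] at c2
  rw [stFT_opD_x h5, stFT_opD_x h4, stFT_opD_t h3, stFT_opD_t hf] at c3
  simp only [norm_mul, Complex.norm_I, Complex.norm_real, Complex.norm_intCast, Complex.norm_ofNat,
    Real.norm_eq_abs, mul_one, abs_of_pos Real.pi_pos, ← hX] at c1 c2 c3
  have p1 : (k:ℝ)^2 * X ≤ C1 := by
    refine le_trans ?_ c1
    calc (k:ℝ)^2 * X = |(k:ℝ)| * (|(k:ℝ)| * X) := by rw [← sq_abs]; ring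
      _ ≤ (2 * Real.pi * |(k:ℝ)|) * ((2 * Real.pi * |(k:ℝ)|) * X) := by
        gcongr <;> exact le_mul_of_one_le_left (abs_nonneg _) hpi
  have p2 : η^2 * X ≤ C2 := by
    refine le_trans ?_ c2
    calc η^2 * X = |η| * (|η| * X) := by rw [← sq_abs]; ring
      _ ≤ (2 * Real.pi * |η|) * ((2 * Real.pi * |η|) * X) := by
        gcongr <;> exact le_mul_of_one_le_left (abs_nonneg _) hpi
  have p3 : (k:ℝ)^2 * (η^2 * X) ≤ C3 := by
    refine le_trans ?_ c3
    calc (k:ℝ)^2 * (η^2 * X) = |(k:ℝ)| * (|(k:ℝ)| * (|η| * (|η| * X))) := by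
          rw [← sq_abs η, ← sq_abs (k:ℝ)]; ring
      _ ≤ (2 * Real.pi * |(k:ℝ)|) * ((2 * Real.pi * |(k:ℝ)|) *
            ((2 * Real.pi * |η|) * ((2 * Real.pi * |η|) * X))) := by
        gcongr <;> exact le_mul_of_one_le_left (abs_nonneg _) hpi
  rw [mul_assoc, ← mul_inv, ← div_eq_mul_inv, le_div_iff₀ (by positivity)]
  nlinarith

end fourierBasics


section inversion
open scoped ENNReal

lemma fourier_inv1 {g : ℝ → ℂ} (hc : Continuous g) (hi : Integrable g)
    (hG : Integrable (fun η : ℝ => ∫ t : ℝ, g t * ex (-(η * t)))) (t : ℝ) :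
    g t = ∫ η : ℝ, (∫ s : ℝ, g s * ex (-(η * s))) * ex (η * t) := by
  have e : FourierTransform.fourier g = fun η : ℝ => ∫ t : ℝ, g t * ex (-(η * t)) := by
    ext η
    rw [Real.fourier_real_eq_integral_exp_smul]
    congr 1; ext s
    rw [smul_eq_mul, mul_comm]
    unfold ex
    congr 2; push_cast; ring
  have h := hc.fourierInv_fourier_eq hi (by rw [e]; exact hG)
  conv_lhs => rw [← h]
  rw [Real.fourierInv_eq', e]
  congr 1; ext η
  rw [smul_eq_mul, mul_comm]
  unfold ex
  congr 2; simp; ring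

/-- Spatial Fourier coefficient as a function of time. -/
noncomputable def tc (f : ℝ → ℝ → ℂ) (k : ℤ) (t : ℝ) : ℂ := torusCoeff (fun x => f x t) k

variable {f h : ℝ → ℝ → ℂ}

lemma tc_cont (hf : SmoothCptTime f) (k : ℤ) : Continuous (tc f k) := by
  have : tc f k = fun t => ∫ x in (0:ℝ)..1, f x t * ex (-(k * x)) := by
    ext t; exact torusCoeff_eq _ _
  rw [this]
  apply intervalIntegral.continuous_parametric_intervalIntegral_of_continuous'
  have h1 : Continuous (fun p : ℝ × ℝ => f p.2 p.1) :=
    hf.cont.comp (by fun_prop : Continuous fun p : ℝ × ℝ => (p.2, p.1))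
  have h2 : Continuous (fun p : ℝ × ℝ => ex (-(k * p.2))) := ex_cont.comp (by fun_prop)
  exact h1.mul h2

lemma tc_supp (hf : SmoothCptTime f) : ∃ T : ℝ, ∀ k t, T ≤ |t| → tc f k t = 0 := by
  obtain ⟨T, hT⟩ := hf.2.2
  refine ⟨T, fun k t ht => ?_⟩
  unfold tc
  rw [torusCoeff_eq]
  simp [hT _ t ht]

lemma integrable_cpt {g : ℝ → ℂ} (hg : Continuous g) {T : ℝ} (hT : ∀ t, T ≤ |t| → g t = 0) :
    Integrable g := by
  refine hg.integrable_of_hasCompactSupport ?_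
  refine HasCompactSupport.intro (isCompact_Icc (a := -T) (b := T)) ?_
  intro t ht
  apply hT
  by_contra hlt
  push Not at hlt
  exact ht (abs_le.1 hlt.le)

lemma tc_int (hf : SmoothCptTime f) (k : ℤ) : Integrable (tc f k) := by
  obtain ⟨T, hT⟩ := tc_supp hf
  exact integrable_cpt (tc_cont hf k) (hT k)

lemma stFT_tc (f : ℝ → ℝ → ℂ) (k : ℤ) (η : ℝ) :
    stFT f k η = ∫ t : ℝ, tc f k t * ex (-(η * t)) := stFT_eq_torus f k η

lemma stFT_cont (hf : SmoothCptTime f) (k : ℤ) : Continuous (stFT f k) := by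
  have : stFT f k = fun η => ∫ t : ℝ, tc f k t * ex (-(η * t)) := by ext η; exact stFT_tc f k η
  rw [this]
  refine continuous_of_dominated (bound := fun t => ‖tc f k t‖) ?_ ?_ (tc_int hf k).norm ?_
  · intro η
    exact ((tc_cont hf k).mul (ex_cont.comp (by fun_prop))).aestronglyMeasurable
  · intro η
    filter_upwards with t
    rw [norm_mul, ex_norm, mul_one]
  · filter_upwards with t
    exact continuous_const.mul (ex_cont.comp (by fun_prop))

lemma stFT_meas (hf : SmoothCptTime f) : Measurable (fun z : ℤ × ℝ => stFT f z.1 z.2) :=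
  measurable_from_prod_countable_right (fun k => (stFT_cont hf k).measurable)

lemma summable_inv_sq : Summable (fun k : ℤ => (1 + (k:ℝ) ^ 2)⁻¹) := by
  have h1 : Summable (fun k : ℤ => 1 / (k:ℝ) ^ 2) := Real.summable_one_div_int_pow.2 (by norm_num)
  refine Summable.of_norm_bounded_eventually (g := fun k : ℤ => 1 / (k:ℝ) ^ 2) h1 ?_
  have : ∀ᶠ k : ℤ in Filter.cofinite, k ≠ 0 := by
    simpa using (Set.finite_singleton (0:ℤ)).eventually_cofinite_notMem
  filter_upwards [this] with k hk
  have hk2 : 0 < (k:ℝ)^2 := by positivity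
  rw [Real.norm_of_nonneg (by positivity), one_div]
  exact inv_anti₀ hk2 (by linarith)

lemma stFT_int_stM (hf : SmoothCptTime f) : Integrable (fun z : ℤ × ℝ => stFT f z.1 z.2) stM := by
  obtain ⟨C, hC, hb⟩ := stFT_decay hf
  have h1 : Integrable (fun k : ℤ => (C * (1 + (k:ℝ) ^ 2)⁻¹)) Measure.count := by
    rw [integrable_count_iff]
    exact (summable_inv_sq.mul_left C).norm
  have h2 := h1.mul_prod (ν := volume) integrable_inv_one_add_sq
  refine h2.mono' (stFT_meas hf).aestronglyMeasurable ?_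
  filter_upwards with z
  exact hb _ _

lemma stFT_int (hf : SmoothCptTime f) (k : ℤ) : Integrable (stFT f k) := by
  obtain ⟨C, hC, hb⟩ := stFT_decay hf
  refine (integrable_inv_one_add_sq.const_mul (C * (1 + (k:ℝ) ^ 2)⁻¹)).mono'
    (stFT_cont hf k).aestronglyMeasurable ?_
  filter_upwards with η
  exact hb _ _

lemma tc_inv (hf : SmoothCptTime f) (k : ℤ) (t : ℝ) :
    tc f k t = ∫ η : ℝ, stFT f k η * ex (η * t) := by
  have h1 : (fun η : ℝ => ∫ t : ℝ, tc f k t * ex (-(η * t))) = stFT f k := by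
    ext η; exact (stFT_tc f k η).symm
  have := fourier_inv1 (tc_cont hf k) (tc_int hf k) (by rw [h1]; exact stFT_int hf k) t
  simpa only [← stFT_tc] using this

lemma tc_decay (hf : SmoothCptTime f) : ∃ C : ℝ, 0 ≤ C ∧ ∀ (k : ℤ) (t : ℝ),
    ‖tc f k t‖ ≤ C * (1 + (k:ℝ) ^ 2)⁻¹ := by
  obtain ⟨C, hC, hb⟩ := stFT_decay hf
  refine ⟨C * ∫ η : ℝ, (1 + η ^ 2)⁻¹, mul_nonneg hC (integral_nonneg fun _ => by positivity), ?_⟩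
  intro k t
  rw [tc_inv hf]
  calc _ ≤ ∫ η : ℝ, C * (1 + (k:ℝ) ^ 2)⁻¹ * (1 + η ^ 2)⁻¹ := by
        refine norm_integral_le_of_norm_le (integrable_inv_one_add_sq.const_mul _) ?_
        filter_upwards with η
        rw [norm_mul, ex_norm, mul_one]; exact hb _ _
    _ = _ := by rw [integral_const_mul]; ring

lemma tc_series (hf : SmoothCptTime f) (x t : ℝ) :
    HasSum (fun k : ℤ => tc f k t * ex (k * x)) (f x t) := by
  have hT : Fact ((0:ℝ) < 1) := ⟨one_pos⟩
  have hfx : Continuous fun x : ℝ => f x t := hf.cont.comp (by fun_prop : Continuous fun x : ℝ => (x, t))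
  have hper : Function.Periodic (fun x => f x t) 1 := fun x => hf.2.1 x t
  let F : C(AddCircle (1:ℝ), ℂ) := ⟨hper.lift, continuous_coinduced_dom.mpr hfx⟩
  have hF : ∀ y : ℝ, F (y : AddCircle (1:ℝ)) = f y t := fun y => hper.lift_coe y
  have hco : ∀ k : ℤ, fourierCoeff F k = tc f k t := by
    intro k
    rw [fourierCoeff_eq_intervalIntegral _ k 0]
    unfold tc
    rw [torusCoeff_eq]
    simp only [div_one, one_smul, zero_add, hF]
    congr 1; ext y
    rw [fourier_coe_apply, smul_eq_mul, mul_comm]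
    unfold ex
    congr 2; push_cast; ring
  obtain ⟨C, hC, hb⟩ := tc_decay hf
  have hs : Summable (fourierCoeff F) := by
    refine Summable.of_norm_bounded (g := fun k : ℤ => C * (1 + (k:ℝ) ^ 2)⁻¹)
      (summable_inv_sq.mul_left C) ?_
    intro k; rw [hco]; exact hb k t
  have := has_pointwise_sum_fourier_series_of_summable hs (x : AddCircle (1:ℝ))
  rw [hF] at this
  convert! this using 2 with k
  rw [hco, fourier_coe_apply, smul_eq_mul]
  unfold ex
  congr 2; push_cast; ring

lemma st_inv (hf : SmoothCptTime f) (x t : ℝ) :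
    f x t = ∫ z, stFT f z.1 z.2 * ex (z.1 * x + z.2 * t) ∂stM := by
  have hm : Measurable (fun z : ℤ × ℝ => ex (z.1 * x + z.2 * t)) := by
    have h : Measurable (fun z : ℤ × ℝ => (z.1 : ℝ)) := (int_fn_meas _).comp measurable_fst
    exact ex_meas.comp (by fun_prop)
  have hi : Integrable (fun z : ℤ × ℝ => stFT f z.1 z.2 * ex (z.1 * x + z.2 * t)) stM := by
    refine (stFT_int_stM hf).mono ((stFT_meas hf).mul hm).aestronglyMeasurable ?_
    filter_upwards with z
    rw [norm_mul, ex_norm, mul_one]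
  rw [integral_prod _ hi, integral_countable hi.integral_prod_left]
  rw [← (tc_series hf x t).tsum_eq]
  congr 1; ext k
  simp only [Measure.real, Measure.count_singleton, ENNReal.toReal_one, one_smul]
  rw [tc_inv hf, ← integral_mul_const]
  congr 1; ext η
  rw [ex_add]; ring

/-- size of the spacetime Fourier transform -/
noncomputable def Sf (f : ℝ → ℝ → ℂ) (z : ℤ × ℝ) : ℝ≥0∞ := ‖stFT f z.1 z.2‖ₑ

lemma Sf_meas (hf : SmoothCptTime f) : Measurable (Sf f) := (stFT_meas hf).enorm

lemma stFT_mul (hf : SmoothCptTime f) (hh : SmoothCptTime h) (z : ℤ × ℝ) :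
    stFT (fun x t => f x t * h x t) z.1 z.2 =
      ∫ p, stFT f p.1 p.2 * stFT h (z - p).1 (z - p).2 ∂stM := by
  have hez : Continuous fun X : ℝ × ℝ => ex (-(z.1 * X.1 + z.2 * X.2)) := ex_cont.comp (by fun_prop)
  have key := integral_integral_swap (μ := nuM) (ν := stM)
    (f := fun X p => (stFT f p.1 p.2 * ex (p.1 * X.1 + p.2 * X.2)) *
      (h X.1 X.2 * ex (-(z.1 * X.1 + z.2 * X.2)))) ?_
  · rw [stFT_nuM (hf.mul hh)]
    convert! key using 1
    · congr 1; ext X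
      rw [integral_mul_const, ← st_inv hf]; ring
    · congr 1; ext p
      rw [stFT_nuM hh, ← integral_const_mul]
      congr 1; ext X
      have : ex (-(((z - p).1 : ℤ) * X.1 + (z - p).2 * X.2)) =
          ex (p.1 * X.1 + p.2 * X.2) * ex (-(z.1 * X.1 + z.2 * X.2)) := by
        rw [← ex_add]; congr 1; simp only [Prod.fst_sub, Prod.snd_sub]; push_cast; ring
      rw [this]; ring
  · have h1 := (hh.integrable hez).mul_prod (stFT_int_stM hf)
    have hm : Measurable (fun q : (ℝ × ℝ) × (ℤ × ℝ) => ex (q.2.1 * q.1.1 + q.2.2 * q.1.2)) := by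
      have h : Measurable (fun q : (ℝ × ℝ) × (ℤ × ℝ) => (q.2.1 : ℝ)) :=
        (int_fn_meas _).comp (measurable_fst.comp measurable_snd)
      exact ex_meas.comp (by fun_prop)
    have h2 : Integrable (fun q : (ℝ × ℝ) × (ℤ × ℝ) =>
      (h q.1.1 q.1.2 * ex (-(z.1 * q.1.1 + z.2 * q.1.2)) * stFT f q.2.1 q.2.2) *
        ex (q.2.1 * q.1.1 + q.2.2 * q.1.2)) (nuM.prod stM) := by
      refine h1.mono (h1.aestronglyMeasurable.mul hm.aestronglyMeasurable) ?_
      filter_upwards with q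
      rw [norm_mul, ex_norm, mul_one]
    refine h2.congr ?_
    filter_upwards with q
    simp only [Function.uncurry]; ring

lemma Sf_mul (hf : SmoothCptTime f) (hh : SmoothCptTime h) (z : ℤ × ℝ) :
    Sf (fun x t => f x t * h x t) z ≤ ∫⁻ p, Sf f p * Sf h (z - p) ∂stM := by
  unfold Sf
  rw [stFT_mul hf hh]
  refine (enorm_integral_le_lintegral_enorm _).trans (le_of_eq ?_)
  congr 1; ext p; rw [enorm_mul]

lemma ex_conj (a : ℝ) : (starRingEnd ℂ) (ex a) = ex (-a) := by
  unfold ex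
  rw [← Complex.exp_conj]; congr 1
  simp only [map_mul, Complex.conj_I, Complex.conj_ofReal, Complex.ofReal_neg, Complex.conj_ofNat]
  ring

lemma stFT_conj (hf : SmoothCptTime f) (k : ℤ) (η : ℝ) :
    stFT (fun x t => (starRingEnd ℂ) (f x t)) k η = (starRingEnd ℂ) (stFT f (-k) (-η)) := by
  rw [stFT_nuM hf.conj, stFT_nuM hf, ← integral_conj]
  congr 1; ext p
  rw [map_mul, ex_conj]; congr 2; push_cast; ring

lemma Sf_conj (hf : SmoothCptTime f) (z : ℤ × ℝ) :
    Sf (fun x t => (starRingEnd ℂ) (f x t)) z = Sf f (-z) := by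
  unfold Sf
  rw [stFT_conj hf]
  simp [← ofReal_norm]

end inversion


section cutoff
open scoped ENNReal

/-- real version of `Kd` -/
noncomputable def kd (δ x : ℝ) : ℝ := δ * ((1 + |δ * x|) ^ 2)⁻¹

lemma kd_nonneg {δ : ℝ} (hδ : 0 < δ) (x : ℝ) : 0 ≤ kd δ x := by unfold kd; positivity

lemma Kd_eq {δ : ℝ} (hδ : 0 < δ) (x : ℝ) : Kd δ x = ENNReal.ofReal (kd δ x) := by
  unfold Kd kd jb
  rw [ENNReal.ofReal_mul hδ.le, Real.rpow_neg (by positivity)]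
  norm_num

/-- Fourier transform of the rescaled cutoff. -/
noncomputable def phi (χ : ℝ → ℂ) (δ x : ℝ) : ℂ := ∫ t : ℝ, χ (t / δ) * ex (-(x * t))

lemma phi_scale (χ : ℝ → ℂ) {δ : ℝ} (hδ : 0 < δ) (x : ℝ) :
    phi χ δ x = δ * phi χ 1 (δ * x) := by
  unfold phi
  have := Measure.integral_comp_div (fun t : ℝ => χ t * ex (-(δ * x * t))) δ
  simp only [div_one]
  rw [abs_of_pos hδ, Complex.real_smul] at this
  rw [← this]
  congr 1; ext t
  congr 3; field_simp

lemma phi_schwartz {χ : ℝ → ℂ} (hχ : ContDiff ℝ (⊤ : ℕ∞) χ) (hχc : HasCompactSupport χ) :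
    ∃ S : SchwartzMap ℝ ℂ, ∀ x, S x = phi χ 1 x := by
  refine ⟨FourierTransform.fourier (hχc.toSchwartzMap hχ), ?_⟩
  intro x
  rw [SchwartzMap.fourier_coe, Real.fourier_real_eq_integral_exp_smul]
  unfold phi
  congr 1; ext s
  rw [smul_eq_mul, mul_comm, div_one]
  unfold ex
  congr 2; push_cast; ring

lemma schwartz_decay (S : SchwartzMap ℝ ℂ) : ∃ C : ℝ, 0 ≤ C ∧ ∀ x, ‖S x‖ ≤ C * ((1 + |x|) ^ 2)⁻¹ := by
  refine ⟨2 ^ 2 * (Finset.Iic ((2, 0) : ℕ × ℕ)).sup (fun m => SchwartzMap.seminorm ℝ m.1 m.2) S,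
    mul_nonneg (by norm_num) (apply_nonneg _ _), fun x => ?_⟩
  rw [← div_eq_mul_inv, le_div_iff₀ (by positivity), mul_comm]
  have := SchwartzMap.one_add_le_sup_seminorm_apply (𝕜 := ℝ) (m := (2, 0)) (k := 2) (n := 0)
    le_rfl le_rfl S x
  simpa using this

lemma phi_bound {χ : ℝ → ℂ} (hχ : ContDiff ℝ (⊤ : ℕ∞) χ) (hχc : HasCompactSupport χ) :
    ∃ C : ℝ, 0 ≤ C ∧ ∀ δ : ℝ, 0 < δ → ∀ x, ‖phi χ δ x‖ ≤ C * kd δ x := by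
  obtain ⟨S, hS⟩ := phi_schwartz hχ hχc
  obtain ⟨C, hC, h⟩ := schwartz_decay S
  refine ⟨C, hC, fun δ hδ x => ?_⟩
  rw [phi_scale χ hδ, ← hS, norm_mul, Complex.norm_real, Real.norm_of_nonneg hδ.le]
  unfold kd
  calc _ ≤ δ * (C * ((1 + |δ * x|) ^ 2)⁻¹) := by gcongr; exact h _
    _ = _ := by ring

lemma phi_diff_bound {χ : ℝ → ℂ} (hχ : ContDiff ℝ (⊤ : ℕ∞) χ) (hχc : HasCompactSupport χ) :
    ∃ C : ℝ, 0 ≤ C ∧ ∀ δ : ℝ, 0 < δ → δ < 1 → ∀ x τ, |τ| ≤ 1 →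
      ‖phi χ δ (x - τ) - phi χ δ x‖ ≤ C * |τ| * kd δ x := by
  obtain ⟨S, hS⟩ := phi_schwartz hχ hχc
  obtain ⟨C, hC, h⟩ := schwartz_decay (SchwartzMap.derivCLM ℝ ℂ S)
  refine ⟨4 * C, by positivity, fun δ hδ hδ1 x τ hτ => ?_⟩
  rw [phi_scale χ hδ, phi_scale χ hδ, ← hS, ← hS, ← mul_sub, norm_mul, Complex.norm_real,
    Real.norm_of_nonneg hδ.le]
  have hdt : |δ * τ| ≤ 1 := by
    rw [abs_mul, abs_of_pos hδ]; nlinarith [abs_nonneg τ]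
  have hmv : ‖S (δ * (x - τ)) - S (δ * x)‖ ≤
      (4 * C * ((1 + |δ * x|) ^ 2)⁻¹) * ‖δ * (x - τ) - δ * x‖ := by
    refine (convex_uIcc (δ * x) (δ * (x - τ))).norm_image_sub_le_of_norm_deriv_le (𝕜 := ℝ) (f := S) ?_ ?_
      Set.left_mem_uIcc Set.right_mem_uIcc
    · intro y _; exact S.differentiable.differentiableAt
    · intro y hy
      have h1 := h y
      rw [SchwartzMap.derivCLM_apply] at h1
      refine h1.trans ?_
      have h2 : |y - δ * x| ≤ |δ * (x - τ) - δ * x| := Set.abs_sub_left_of_mem_uIcc hy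
      rw [show δ * (x - τ) - δ * x = -(δ * τ) by ring, abs_neg] at h2
      have h3 : |δ * x| ≤ |y| + |y - δ * x| := by
        have := abs_sub y (y - δ * x)
        simpa using this
      have h4 : 1 + |δ * x| ≤ 2 * (1 + |y|) := by linarith [abs_nonneg y]
      have h5 : ((1 + |y|) ^ 2)⁻¹ ≤ 4 * ((1 + |δ * x|) ^ 2)⁻¹ := by
        rw [← div_eq_mul_inv, inv_eq_one_div, div_le_div_iff₀ (by positivity) (by positivity)]
        have := pow_le_pow_left₀ (by positivity) h4 2
        linarith
      nlinarith
  rw [show δ * (x - τ) - δ * x = -(δ * τ) by ring, norm_neg, Real.norm_eq_abs, abs_mul δ τ,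
    abs_of_pos hδ] at hmv
  calc _ ≤ δ * ((4 * C * ((1 + |δ * x|) ^ 2)⁻¹) * (δ * |τ|)) := by gcongr
    _ = 4 * C * |τ| * kd δ x * δ := by unfold kd; ring
    _ ≤ 4 * C * |τ| * kd δ x * 1 := by
      gcongr
      exact mul_nonneg (by positivity) (kd_nonneg hδ x)
    _ = _ := by ring

lemma ex_prim {τ : ℝ} (hτ : τ ≠ 0) (t : ℝ) :
    ∫ s in (0:ℝ)..t, ex (τ * s) = (ex (τ * t) - 1) / (2 * Real.pi * Complex.I * τ) := by
  have hne : (2 * Real.pi * Complex.I * τ : ℂ) ≠ 0 := by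
    simp [hτ, Real.pi_ne_zero]
  have := intervalIntegral.integral_eq_sub_of_hasDerivAt (a := 0) (b := t)
    (f := fun s : ℝ => ex (τ * s + 0) / (2 * Real.pi * Complex.I * τ)) (f' := fun s => ex (τ * s)) (by
      intro s _
      have h := (ex_hasDerivAt τ 0 s).div_const (2 * Real.pi * Complex.I * τ)
      convert! h using 1
      rw [add_zero, mul_div_cancel_left₀ _ hne])
    ((ex_cont.comp (by fun_prop : Continuous fun s : ℝ => τ * s)).intervalIntegrable _ _)
  rw [this]
  simp only [add_zero, mul_zero, ex_zero]
  ring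

/-- the Duhamel kernel -/
noncomputable def dk (χ : ℝ → ℂ) (δ η τ : ℝ) : ℂ :=
  ∫ t : ℝ, χ (t / δ) * (∫ s in (0:ℝ)..t, ex (τ * s)) * ex (-(η * t))

lemma cut_int {χ : ℝ → ℂ} (hχ : Continuous χ) (hχc : HasCompactSupport χ) {δ : ℝ} (hδ : 0 < δ)
    {e : ℝ → ℂ} (he : Continuous e) : Integrable (fun t : ℝ => χ (t / δ) * e t) := by
  have h1 : HasCompactSupport (fun t : ℝ => χ (t / δ)) :=
    hχc.comp_homeomorph (Homeomorph.mulRight₀ δ⁻¹ (inv_ne_zero hδ.ne'))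
  exact ((hχ.comp (by fun_prop)).mul he).integrable_of_hasCompactSupport h1.mul_right

lemma dk_eq {χ : ℝ → ℂ} (hχ : Continuous χ) (hχc : HasCompactSupport χ) {δ : ℝ} (hδ : 0 < δ)
    {τ : ℝ} (hτ : τ ≠ 0) (η : ℝ) :
    dk χ δ η τ = (phi χ δ (η - τ) - phi χ δ η) / (2 * Real.pi * Complex.I * τ) := by
  unfold dk phi
  rw [← integral_sub, ← integral_div]
  · congr 1; ext t
    rw [ex_prim hτ, show -((η - τ) * t) = τ * t + -(η * t) by ring, ex_add]
    ring
  · exact cut_int hχ hχc hδ (ex_cont.comp (by fun_prop))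
  · exact cut_int hχ hχc hδ (ex_cont.comp (by fun_prop))

lemma dk_bound {χ : ℝ → ℂ} (hχ : ContDiff ℝ (⊤ : ℕ∞) χ) (hχc : HasCompactSupport χ) :
    ∃ C : ℝ, 0 ≤ C ∧ ∀ δ : ℝ, 0 < δ → δ < 1 → ∀ η τ, τ ≠ 0 →
      ‖dk χ δ η τ‖ ≤ C * ((kd δ (η - τ) + kd δ η) * (1 + |τ|)⁻¹) := by
  obtain ⟨C1, hC1, h1⟩ := phi_bound hχ hχc
  obtain ⟨C2, hC2, h2⟩ := phi_diff_bound hχ hχc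
  refine ⟨2 * (C1 + C2), by positivity, fun δ hδ hδ1 η τ hτ => ?_⟩
  rw [dk_eq hχ.continuous hχc hδ hτ, norm_div]
  have hτ0 : 0 < |τ| := abs_pos.2 hτ
  have hn : ‖(2 * Real.pi * Complex.I * τ : ℂ)‖ = 2 * Real.pi * |τ| := by
    simp [abs_of_pos Real.pi_pos]
  rw [hn]
  have k1 := kd_nonneg hδ (η - τ)
  have k2 := kd_nonneg hδ η
  have hpi : 1 ≤ 2 * Real.pi := by linarith [Real.pi_gt_three]
  have step : ‖phi χ δ (η - τ) - phi χ δ η‖ / (2 * Real.pi * |τ|) ≤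
      ‖phi χ δ (η - τ) - phi χ δ η‖ / |τ| := by
    gcongr
    nlinarith
  refine step.trans ?_
  rw [← div_eq_mul_inv, ← mul_div_assoc, div_le_div_iff₀ hτ0 (by positivity)]
  rcases le_total |τ| 1 with h | h
  · have := h2 δ hδ hδ1 η τ h
    calc _ ≤ (C2 * |τ| * kd δ η) * 2 := by gcongr; linarith
      _ = 2 * (0 + C2) * (0 + kd δ η) * |τ| := by ring
      _ ≤ _ := by gcongr
  · have := (norm_sub_le (phi χ δ (η - τ)) (phi χ δ η)).trans (add_le_add (h1 δ hδ _) (h1 δ hδ _))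
    calc _ ≤ (C1 * kd δ (η - τ) + C1 * kd δ η) * (2 * |τ|) := by gcongr; linarith
      _ = 2 * (C1 + 0) * (kd δ (η - τ) + kd δ η) * |τ| := by ring
      _ ≤ _ := by gcongr

end cutoff


section duhamelFormula
open scoped ENNReal

variable {f h : ℝ → ℝ → ℂ}

lemma stFT_timeMul (hf : SmoothCptTime f) {ψ : ℝ → ℂ} (hψ : Continuous ψ)
    (hψc : HasCompactSupport ψ) {δ : ℝ} (hδ : 0 < δ) (k : ℤ) (η : ℝ) :
    stFT (fun x t => ψ (t / δ) * f x t) k η = ∫ ζ : ℝ, phi ψ δ (η - ζ) * stFT f k ζ := by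
  have htc : ∀ t, tc (fun x t => ψ (t / δ) * f x t) k t = ψ (t / δ) * tc f k t := by
    intro t
    unfold tc
    rw [torusCoeff_eq, torusCoeff_eq, ← intervalIntegral.integral_const_mul]
    congr 1; ext x; ring
  have he : Continuous fun t : ℝ => ex (-(η * t)) := ex_cont.comp (by fun_prop)
  have key := integral_integral_swap (μ := (volume : Measure ℝ)) (ν := (volume : Measure ℝ))
    (f := fun t ζ => (ψ (t / δ) * ex (-(η * t))) * (stFT f k ζ * ex (ζ * t))) ?_
  · rw [stFT_tc]
    convert! key using 1
    · congr 1; ext t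
      rw [htc, integral_const_mul, ← tc_inv hf]; ring
    · congr 1; ext ζ
      unfold phi
      rw [← integral_mul_const]
      congr 1; ext t
      rw [show -((η - ζ) * t) = -(η * t) + ζ * t by ring, ex_add]; ring
  · have h1 := (cut_int hψ hψc hδ he).mul_prod (stFT_int hf k)
    have hm : Continuous (fun q : ℝ × ℝ => ex (q.2 * q.1)) := ex_cont.comp (by fun_prop)
    have h2 : Integrable (fun q : ℝ × ℝ =>
      (ψ (q.1 / δ) * ex (-(η * q.1)) * stFT f k q.2) * ex (q.2 * q.1)) (volume.prod volume) := by
      refine h1.mono (h1.aestronglyMeasurable.mul hm.aestronglyMeasurable) ?_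
      filter_upwards with q
      rw [norm_mul, ex_norm, mul_one]
    refine h2.congr ?_
    filter_upwards with q
    simp only [Function.uncurry]; ring

lemma ex_orth (j k : ℤ) : ∫ x in (0:ℝ)..1, ex (j * x) * ex (-(k * x)) = if j = k then 1 else 0 := by
  have h1 : ∀ x : ℝ, ex (j * x) * ex (-(k * x)) = ex (((j - k : ℤ) : ℝ) * x) := by
    intro x; rw [← ex_add]; congr 1; push_cast; ring
  simp only [h1]
  split_ifs with h
  · subst h; simp [ex_zero]
  · have hne : ((j - k : ℤ) : ℝ) ≠ 0 := by
      exact_mod_cast sub_ne_zero.2 h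
    rw [ex_prim hne, mul_one, ex_int]; simp

lemma torusCoeff_tsum {a : ℤ → ℂ} (ha : Summable fun j => ‖a j‖) (k : ℤ) :
    torusCoeff (fun x => ∑' j : ℤ, a j * ex (j * x)) k = a k := by
  rw [torusCoeff_eq]
  have H := intervalIntegral.hasSum_integral_of_dominated_convergence (μ := volume) (a := 0) (b := 1)
    (F := fun (j : ℤ) (x : ℝ) => a j * ex (j * x) * ex (-(k * x)))
    (f := fun x => (∑' j : ℤ, a j * ex (j * x)) * ex (-(k * x)))
    (fun j _ => ‖a j‖) ?_ ?_ ?_ ?_ ?_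
  · rw [← H.tsum_eq]
    have : ∀ j : ℤ, ∫ x in (0:ℝ)..1, a j * ex (j * x) * ex (-(k * x)) = if j = k then a j else 0 := by
      intro j
      simp only [mul_assoc]
      rw [intervalIntegral.integral_const_mul, ex_orth]
      split_ifs <;> simp
    simp only [this]
    exact tsum_ite_eq k a
  · intro j
    exact ((continuous_const.mul (ex_cont.comp (by fun_prop))).mul
      (ex_cont.comp (by fun_prop))).aestronglyMeasurable
  · intro j
    filter_upwards with x _
    rw [norm_mul, norm_mul, ex_norm, ex_norm, mul_one, mul_one]
  · filter_upwards with x _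
    exact ha
  · exact intervalIntegrable_const
  · filter_upwards with x _
    refine HasSum.mul_right _ (Summable.hasSum ?_)
    refine Summable.of_norm ?_
    simpa only [norm_mul, ex_norm, mul_one] using ha

lemma prop_eq (s : ℝ) (Φ : ℝ → ℂ) (x : ℝ) :
    schrodingerProp s Φ x = ∑' k : ℤ, torusCoeff Φ k * ex (k * x - 2 * Real.pi * k ^ 2 * s) := by
  unfold schrodingerProp ex
  congr 1; ext k; congr 2; push_cast; ring

lemma duh_tc {N : ℝ → ℝ → ℂ} (hN : SmoothCptTime N) (c : ℂ) (k : ℤ) (t : ℝ) :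
    torusCoeff (fun x => c * ∫ t' in (0:ℝ)..t, schrodingerProp (t - t') (fun y => N y t') x) k =
      c * (ex (-(2 * Real.pi * k ^ 2 * t)) *
        ∫ t' in (0:ℝ)..t, tc N k t' * ex (2 * Real.pi * k ^ 2 * t')) := by
  obtain ⟨C, hC, hb⟩ := tc_decay hN
  have hcont : ∀ j : ℤ, Continuous fun t' : ℝ => tc N j t' * ex (2 * Real.pi * j ^ 2 * t') :=
    fun j => (tc_cont hN j).mul (ex_cont.comp (by fun_prop))
  set a : ℤ → ℂ := fun j => c * (ex (-(2 * Real.pi * j ^ 2 * t)) *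
        ∫ t' in (0:ℝ)..t, tc N j t' * ex (2 * Real.pi * j ^ 2 * t')) with ha
  have hsum : Summable fun j => ‖a j‖ := by
    refine Summable.of_nonneg_of_le (fun _ => norm_nonneg _) (fun j => ?_)
      (summable_inv_sq.mul_left (‖c‖ * (C * |t|)))
    rw [ha, norm_mul, norm_mul, ex_norm, one_mul]
    have := intervalIntegral.norm_integral_le_of_norm_le_const (a := 0) (b := t)
      (C := C * (1 + (j:ℝ) ^ 2)⁻¹) (f := fun t' => tc N j t' * ex (2 * Real.pi * j ^ 2 * t'))
      (fun x _ => by rw [norm_mul, ex_norm, mul_one]; exact hb j x)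
    rw [sub_zero] at this
    calc _ ≤ ‖c‖ * (C * (1 + (j:ℝ) ^ 2)⁻¹ * |t|) := by gcongr
      _ = _ := by ring
  change _ = a k
  rw [← torusCoeff_tsum hsum k]
  congr 1; ext x
  have H := intervalIntegral.hasSum_integral_of_dominated_convergence (μ := volume) (a := 0) (b := t)
    (F := fun (j : ℤ) (t' : ℝ) => tc N j t' * ex (j * x - 2 * Real.pi * j ^ 2 * (t - t')))
    (f := fun t' => schrodingerProp (t - t') (fun y => N y t') x)
    (fun j _ => C * (1 + (j:ℝ) ^ 2)⁻¹) ?_ ?_ ?_ ?_ ?_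
  · rw [← H.tsum_eq, ← tsum_mul_left]
    congr 1; ext j
    rw [ha]
    have : ∀ t' : ℝ, tc N j t' * ex (j * x - 2 * Real.pi * j ^ 2 * (t - t')) =
        (ex (j * x) * ex (-(2 * Real.pi * j ^ 2 * t))) * (tc N j t' * ex (2 * Real.pi * j ^ 2 * t')) := by
      intro t'
      rw [show j * x - 2 * Real.pi * j ^ 2 * (t - t') =
        j * x + -(2 * Real.pi * j ^ 2 * t) + 2 * Real.pi * j ^ 2 * t' by ring, ex_add, ex_add]
      ring
    simp only [this]
    rw [intervalIntegral.integral_const_mul]; ring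
  · intro j
    exact ((tc_cont hN j).mul (ex_cont.comp (by fun_prop))).aestronglyMeasurable
  · intro j
    filter_upwards with t' _
    rw [norm_mul, ex_norm, mul_one]; exact hb j t'
  · filter_upwards with t' _
    exact summable_inv_sq.mul_left C
  · exact intervalIntegrable_const
  · filter_upwards with t' _
    rw [prop_eq]
    refine Summable.hasSum ?_
    refine Summable.of_norm_bounded (g := fun j : ℤ => C * (1 + (j:ℝ) ^ 2)⁻¹)
      (summable_inv_sq.mul_left C) ?_
    intro j
    rw [norm_mul, ex_norm, mul_one]; exact hb j t'

lemma prim_cont : Continuous (fun q : ℝ × ℝ => ∫ s in (0:ℝ)..q.1, ex (q.2 * s)) := by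
  refine intervalIntegral.continuous_parametric_intervalIntegral_of_continuous
    (f := fun (q : ℝ × ℝ) (s : ℝ) => ex (q.2 * s)) ?_ continuous_fst
  exact ex_cont.comp (by fun_prop : Continuous fun p : (ℝ × ℝ) × ℝ => p.1.2 * p.2)

lemma prim_norm (t τ : ℝ) : ‖∫ s in (0:ℝ)..t, ex (τ * s)‖ ≤ |t| := by
  have := intervalIntegral.norm_integral_le_of_norm_le_const (a := 0) (b := t) (C := 1)
    (f := fun s => ex (τ * s)) (fun s _ => by rw [ex_norm])
  simpa using this

lemma stFT_duh {N : ℝ → ℝ → ℂ} (hN : SmoothCptTime N) {χ : ℝ → ℂ} (hχ : Continuous χ)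
    (hχc : HasCompactSupport χ) {δ : ℝ} (hδ : 0 < δ) (k : ℤ) (η : ℝ) :
    stFT (fun x t => χ (t / δ) * ∫ t' in (0:ℝ)..t, schrodingerProp (t - t') (fun y => N y t') x) k η
      = ∫ τ : ℝ, dk χ δ (η + 2 * Real.pi * k ^ 2) τ * stFT N k (τ - 2 * Real.pi * k ^ 2) := by
  set c : ℝ := 2 * Real.pi * k ^ 2 with hc
  have hFint : Integrable fun τ => stFT N k (τ - c) := (stFT_int hN k).comp_sub_right c
  have hFc : Continuous fun τ => stFT N k (τ - c) := (stFT_cont hN k).comp (by fun_prop)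
  have h1 : ∀ t', tc N k t' * ex (c * t') = ∫ τ : ℝ, stFT N k (τ - c) * ex (τ * t') := by
    intro t'
    rw [tc_inv hN, ← integral_mul_const,
      ← integral_sub_right_eq_self (fun τ => stFT N k τ * ex (τ * t') * ex (c * t')) c]
    congr 1; ext τ
    rw [mul_assoc, ← ex_add]; congr 2; ring
  have h2 : ∀ t : ℝ, ∫ t' in (0:ℝ)..t, tc N k t' * ex (c * t') =
      ∫ τ : ℝ, stFT N k (τ - c) * ∫ t' in (0:ℝ)..t, ex (τ * t') := by
    intro t
    simp only [h1]
    rw [intervalIntegral_integral_swap]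
    · simp only [intervalIntegral.integral_const_mul]
    · have i1 : Integrable (fun _ : ℝ => (1:ℂ)) (volume.restrict (Set.uIoc 0 t)) := by
        rw [Set.uIoc]; exact integrable_const _
      have i2 := i1.mul_prod hFint
      have hm : Continuous (fun q : ℝ × ℝ => stFT N k (q.2 - c) * ex (q.2 * q.1)) :=
        (hFc.comp continuous_snd).mul (ex_cont.comp (by fun_prop))
      refine i2.mono hm.aestronglyMeasurable ?_
      filter_upwards with q
      simp only [Function.uncurry]
      rw [norm_mul, ex_norm, mul_one, one_mul]
  have he : Continuous fun t : ℝ => ex (-((η + c) * t)) := ex_cont.comp (by fun_prop)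
  have key := integral_integral_swap (μ := (volume : Measure ℝ)) (ν := (volume : Measure ℝ))
    (f := fun t τ => (χ (t / δ) * ex (-((η + c) * t))) *
      (stFT N k (τ - c) * ∫ s in (0:ℝ)..t, ex (τ * s))) ?_
  · rw [stFT_eq_torus]
    convert! key using 1
    · congr 1; ext t
      rw [duh_tc hN, integral_const_mul, ← hc, h2 t,
        show -((η + c) * t) = -(η * t) + -(c * t) by ring, ex_add]
      ring
    · congr 1; ext τ
      unfold dk
      rw [← integral_mul_const]
      congr 1; ext t
      ring
  · have hcut := cut_int hχ hχc hδ (he.mul (Complex.continuous_ofReal))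
    have i1 := hcut.mul_prod hFint
    have hm : Continuous (fun q : ℝ × ℝ => (χ (q.1 / δ) * ex (-((η + c) * q.1))) *
      (stFT N k (q.2 - c) * ∫ s in (0:ℝ)..q.1, ex (q.2 * s))) :=
      ((hχ.comp (by fun_prop)).mul (he.comp continuous_fst)).mul
        ((hFc.comp continuous_snd).mul prim_cont)
    refine i1.mono hm.aestronglyMeasurable ?_
    filter_upwards with q
    simp only [Function.uncurry]
    simp only [Pi.mul_apply, norm_mul, ex_norm, mul_one, one_mul, Complex.norm_real, Real.norm_eq_abs]
    have := prim_norm q.1 q.2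
    calc _ ≤ ‖χ (q.1 / δ)‖ * (‖stFT N k (q.2 - c)‖ * |q.1|) := by gcongr
      _ = _ := by ring

end duhamelFormula


section assembly
open scoped ENNReal

/-- squared weighted norm -/
noncomputable def X2 (p : ℝ) (f : ℝ → ℝ → ℂ) : ℝ≥0∞ :=
  ∑' k : ℤ, ∫⁻ η : ℝ, jb p (η + 2 * Real.pi * (k : ℝ) ^ 2) * ‖stFT f k η‖ₑ ^ 2

lemma XNorm_eq (b : ℝ) (f : ℝ → ℝ → ℂ) : XNorm 0 b f = X2 (2 * b) f ^ ((1:ℝ)/2) := by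
  unfold XNorm X2 jb
  congr 2; ext k; congr 1; ext η
  rw [mul_zero, Real.rpow_zero, one_mul, ENNReal.ofReal_mul (by positivity),
    ENNReal.ofReal_pow (norm_nonneg _), ofReal_norm]

lemma X2_shift (p : ℝ) (f : ℝ → ℝ → ℂ) : X2 p f =
    ∑' k : ℤ, ∫⁻ η : ℝ, jb p η * ‖stFT f k (η - 2 * Real.pi * (k : ℝ) ^ 2)‖ₑ ^ 2 := by
  unfold X2
  congr 1; ext k
  rw [← lintegral_sub_right_eq_self _ (2 * Real.pi * (k : ℝ) ^ 2)]
  simp only [sub_add_cancel]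

lemma X2_mono {p q : ℝ} (h : p ≤ q) (f : ℝ → ℝ → ℂ) : X2 p f ≤ X2 q f := by
  unfold X2
  refine ENNReal.tsum_le_tsum fun k => lintegral_mono fun η => ?_
  gcongr
  exact jb_mono h _

lemma X2_stM {f : ℝ → ℝ → ℂ} (hf : SmoothCptTime f) (p : ℝ) :
    ∫⁻ z, jw p z * Sf f z ^ 2 ∂stM = X2 p f := by
  have hm : Measurable fun z => jw p z * Sf f z ^ 2 := (jw_meas p).mul ((Sf_meas hf).pow_const 2)
  rw [lintegral_stM hm]
  rfl

lemma stFT_shift_meas {f : ℝ → ℝ → ℂ} (hf : SmoothCptTime f) (k : ℤ) (c : ℝ) :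
    Measurable fun η => ‖stFT f k (η - c)‖ₑ :=
  ((stFT_cont hf k).comp (by fun_prop : Continuous fun η : ℝ => η - c)).measurable.enorm

lemma step_product {b : ℝ} (hb : 1/2 < b) {ψ : ℝ → ℂ} (hψ : ContDiff ℝ (⊤ : ℕ∞) ψ)
    (hψc : HasCompactSupport ψ) : ∃ C : ℝ≥0∞, C < ∞ ∧ ∀ δ : ℝ, 0 < δ → δ < 1 →
    ∀ v, SmoothCptTime v → X2 (4/5) (fun x t => ψ (t / δ) * v x t) ≤
      C * ENNReal.ofReal (δ ^ ((1:ℝ)/8)) * X2 (2 * b) v := by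
  obtain ⟨C1, hC1, h1⟩ := phi_bound hψ hψc
  obtain ⟨C2, hC2, h2⟩ := prod_est_s hb
  refine ⟨ENNReal.ofReal C1 ^ 2 * C2, ENNReal.mul_lt_top (by finiteness) hC2, ?_⟩
  intro δ hδ hδ1 v hv
  rw [X2_shift, X2_shift, ← ENNReal.tsum_mul_left]
  refine ENNReal.tsum_le_tsum fun k => ?_
  set c : ℝ := 2 * Real.pi * (k : ℝ) ^ 2
  have hm := stFT_shift_meas hv k c
  have hpt : ∀ η, ‖stFT (fun x t => ψ (t / δ) * v x t) k (η - c)‖ₑ ≤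
      ENNReal.ofReal C1 * ∫⁻ y, Kd δ (η - y) * ‖stFT v k (y - c)‖ₑ := by
    intro η
    rw [stFT_timeMul hv hψ.continuous hψc hδ]
    refine (enorm_integral_le_lintegral_enorm _).trans ?_
    rw [← lintegral_sub_right_eq_self _ c, ← lintegral_const_mul' _ _ (by finiteness)]
    refine lintegral_mono fun y => ?_
    simp only
    rw [enorm_mul, ← mul_assoc]
    gcongr
    rw [Kd_eq hδ, ← ENNReal.ofReal_mul hC1, ← ofReal_norm]
    apply ENNReal.ofReal_le_ofReal
    have := h1 δ hδ (η - y)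
    rwa [show η - c - (y - c) = η - y by ring]
  calc _ ≤ ∫⁻ η, ENNReal.ofReal C1 ^ 2 *
        (jb (4/5) η * (∫⁻ y, Kd δ (η - y) * ‖stFT v k (y - c)‖ₑ) ^ 2) := by
        refine lintegral_mono fun η => ?_
        calc _ ≤ jb (4/5) η * (ENNReal.ofReal C1 *
              ∫⁻ y, Kd δ (η - y) * ‖stFT v k (y - c)‖ₑ) ^ 2 := by gcongr; exact hpt η
          _ = _ := by ring
    _ = ENNReal.ofReal C1 ^ 2 * ∫⁻ η,
        (jb (4/5) η * (∫⁻ y, Kd δ (η - y) * ‖stFT v k (y - c)‖ₑ) ^ 2) :=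
        lintegral_const_mul' _ _ (by finiteness)
    _ ≤ ENNReal.ofReal C1 ^ 2 * (C2 * ENNReal.ofReal (δ ^ ((1:ℝ)/8)) *
        ∫⁻ y, jb (2 * b) y * ‖stFT v k (y - c)‖ₑ ^ 2) := by
        gcongr; exact h2 δ hδ hδ1 _ hm
    _ = _ := by ring

lemma step_duhamel {b : ℝ} (hb : 1/2 < b) (hb1 : b < 1) {χ : ℝ → ℂ} (hχ : ContDiff ℝ (⊤ : ℕ∞) χ)
    (hχc : HasCompactSupport χ) : ∃ C : ℝ≥0∞, C < ∞ ∧ ∀ δ : ℝ, 0 < δ → δ < 1 →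
    ∀ N, SmoothCptTime N → X2 (2 * b) (fun x t => χ (t / δ) *
        ∫ t' in (0:ℝ)..t, schrodingerProp (t - t') (fun y => N y t') x) ≤
      C * ENNReal.ofReal (δ ^ (1 - 2 * b)) * X2 (2 * b - 2) N := by
  obtain ⟨C1, hC1, h1⟩ := dk_bound hχ hχc
  obtain ⟨C2, hC2, h2⟩ := duh_est hb hb1
  refine ⟨ENNReal.ofReal C1 ^ 2 * C2, ENNReal.mul_lt_top (by finiteness) hC2, ?_⟩
  intro δ hδ hδ1 N hN
  rw [X2_shift, X2_shift, ← ENNReal.tsum_mul_left]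
  refine ENNReal.tsum_le_tsum fun k => ?_
  have hst := fun η => stFT_duh hN hχ.continuous hχc hδ k η
  set c : ℝ := 2 * Real.pi * (k : ℝ) ^ 2
  have hm := stFT_shift_meas hN k c
  have hpt : ∀ η, ‖stFT (fun x t => χ (t / δ) *
        ∫ t' in (0:ℝ)..t, schrodingerProp (t - t') (fun y => N y t') x) k (η - c)‖ₑ ≤
      ENNReal.ofReal C1 * ∫⁻ y, (Kd δ (η - y) + Kd δ η) * (jb (-1) y * ‖stFT N k (y - c)‖ₑ) := by
    intro η
    rw [hst, sub_add_cancel]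
    refine (enorm_integral_le_lintegral_enorm _).trans ?_
    rw [← lintegral_const_mul' _ _ (by finiteness)]
    refine lintegral_mono_ae ?_
    have hae : ∀ᵐ y : ℝ, y ≠ 0 := by simp [ae_iff]
    filter_upwards [hae] with y hy
    rw [enorm_mul, ← mul_assoc, ← mul_assoc]
    gcongr
    have k1 := kd_nonneg hδ (η - y)
    have k2 := kd_nonneg hδ η
    unfold jb
    rw [Kd_eq hδ, Kd_eq hδ, ← ENNReal.ofReal_add k1 k2, ← ENNReal.ofReal_mul hC1,
      ← ENNReal.ofReal_mul (by positivity), ← ofReal_norm]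
    apply ENNReal.ofReal_le_ofReal
    refine (h1 δ hδ hδ1 η y hy).trans (le_of_eq ?_)
    rw [Real.rpow_neg_one]; ring
  calc _ ≤ ∫⁻ η, ENNReal.ofReal C1 ^ 2 *
        (jb (2 * b) η * (∫⁻ y, (Kd δ (η - y) + Kd δ η) *
          (jb (-1) y * ‖stFT N k (y - c)‖ₑ)) ^ 2) := by
        refine lintegral_mono fun η => ?_
        calc _ ≤ jb (2 * b) η * (ENNReal.ofReal C1 *
              ∫⁻ y, (Kd δ (η - y) + Kd δ η) * (jb (-1) y * ‖stFT N k (y - c)‖ₑ)) ^ 2 := by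
              gcongr; exact hpt η
          _ = _ := by ring
    _ = ENNReal.ofReal C1 ^ 2 * ∫⁻ η,
        (jb (2 * b) η * (∫⁻ y, (Kd δ (η - y) + Kd δ η) *
          (jb (-1) y * ‖stFT N k (y - c)‖ₑ)) ^ 2) :=
        lintegral_const_mul' _ _ (by finiteness)
    _ ≤ ENNReal.ofReal C1 ^ 2 * (C2 * ENNReal.ofReal (δ ^ (1 - 2 * b)) *
        ∫⁻ y, jb (2 * b - 2) y * ‖stFT N k (y - c)‖ₑ ^ 2) := by
        gcongr; exact h2 δ hδ hδ1 _ hm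
    _ = _ := by ring

lemma step_trilinear : ∃ M : ℝ≥0∞, M < ∞ ∧ ∀ u, SmoothCptTime u →
    X2 (-4/5) (fun x t => (u x t * u x t) * (starRingEnd ℂ) (u x t)) ≤ M ^ 2 * X2 (4/5) u ^ 3 := by
  obtain ⟨M, hM, hk⟩ := kernel_bound
  refine ⟨M, hM, fun u hu => ?_⟩
  have huu := hu.mul hu
  have hN := huu.mul hu.conj
  rw [← X2_stM hu, ← X2_stM hN]
  refine trilinear_conv stM (P := jw (-4/5)) (w := jw (4/5)) (U := Sf u)
    (A := Sf fun x t => u x t * u x t) (jw_meas _) (jw_meas _) (Sf_meas hu) (Sf_meas huu)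
    (Sf_meas hN) ?_ hk ?_ ?_ ?_
  · intro z
    unfold jw
    rw [jb_mul, show (-4/5 : ℝ) + 4/5 = 0 by norm_num, jb_zero]
  · intro z; exact Sf_mul hu hu z
  · intro z
    refine (Sf_mul huu hu.conj z).trans (le_of_eq ?_)
    congr 1; ext p
    rw [Sf_conj hu, neg_sub]
  · obtain ⟨C, hC, hb⟩ := stFT_bdd hN
    have hi := (stFT_int_stM hN).2
    have hle : ∀ z, jw (-4/5) z * Sf (fun x t => u x t * u x t * (starRingEnd ℂ) (u x t)) z ^ 2 ≤
        ENNReal.ofReal C * Sf (fun x t => u x t * u x t * (starRingEnd ℂ) (u x t)) z := by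
      intro z
      have e1 : jw (-4/5) z ≤ 1 := by
        unfold jw
        rw [← jb_zero (z.2 + 2 * Real.pi * (z.1 : ℝ) ^ 2)]; exact jb_mono (by norm_num) _
      have e2 : Sf (fun x t => u x t * u x t * (starRingEnd ℂ) (u x t)) z ≤ ENNReal.ofReal C := by
        unfold Sf; rw [← ofReal_norm]; exact ENNReal.ofReal_le_ofReal (hb _ _)
      rw [pow_two, ← mul_assoc]
      gcongr
      calc _ ≤ 1 * ENNReal.ofReal C := by gcongr
        _ = _ := one_mul _
    refine ne_top_of_le_ne_top ?_ (lintegral_mono hle)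
    rw [lintegral_const_mul' _ _ (by finiteness)]
    exact ENNReal.mul_ne_top (by finiteness) hi.ne

lemma exponents {b θ θ₀ r₀ : ℝ} (hb : 1/2 < b)
    (hθ : θ = (b - 3/8) / b) (hθ₀ : θ₀ = θ/4 + (1 - θ) * (1 - 2*b) / 2)
    (hr₀ : r₀ = (1 - 2*b)/2 + 3*θ₀) (hpos : 0 < r₀) :
    b < 3/5 ∧ r₀ ≤ (1 - 2 * b) / 2 + 3/16 := by
  have hb0 : 0 < b := by linarith
  have e1 : b * θ = b - 3/8 := by rw [hθ]; field_simp
  have e2 : b * θ₀ = -b/8 + 3/32 := by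
    rw [hθ₀]
    calc b * (θ/4 + (1 - θ) * (1 - 2*b) / 2) = (b*θ)/4 + (b - b*θ) * (1 - 2*b)/2 := by ring
      _ = _ := by rw [e1]; ring
  have e3 : b * r₀ = b * (1 - 2*b)/2 + 3 * (-b/8 + 3/32) := by
    rw [hr₀, ← e2]; ring
  constructor
  · by_contra hcon
    push Not at hcon
    have := mul_pos hb0 hpos
    nlinarith
  · rw [hr₀]
    have : θ₀ ≤ 1/16 := by
      by_contra hcon
      push Not at hcon
      nlinarith
    linarith

lemma cubic_main (b θ θ₀ r₀ : ℝ) (hb : b ∈ Set.Ioo (1/2 : ℝ) 1)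
    (hθ : θ = (b - 3/8) / b) (hθ₀ : θ₀ = θ/4 + (1 - θ) * (1 - 2*b) / 2)
    (hr₀ : r₀ = (1 - 2*b)/2 + 3*θ₀) (hpos : 0 < r₀)
    (χ ψ : ℝ → ℂ) (hχ : ContDiff ℝ (⊤ : ℕ∞) χ) (hχc : HasCompactSupport χ)
    (hψ : ContDiff ℝ (⊤ : ℕ∞) ψ) (hψc : HasCompactSupport ψ) :
    ∃ C : ℝ, 0 < C ∧ ∀ δ : ℝ, δ ∈ Set.Ioo (0:ℝ) 1 → ∀ v : ℝ → ℝ → ℂ, SmoothCptTime v →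
      XNorm 0 b (fun x t => χ (t / δ) *
          ∫ t' in (0:ℝ)..t, schrodingerProp (t - t')
            (fun y => ((‖ψ (t' / δ) * v y t'‖ ^ 2 : ℝ) : ℂ) * (ψ (t' / δ) * v y t')) x)
        ≤ ENNReal.ofReal (C * δ ^ r₀) * XNorm 0 b v ^ (3 : ℕ) := by
  obtain ⟨hb35, hr⟩ := exponents hb.1 hθ hθ₀ hr₀ hpos
  obtain ⟨C1, hC1, h1⟩ := step_product hb.1 hψ hψc
  obtain ⟨C2, hC2, h2⟩ := step_duhamel hb.1 hb.2 hχ hχc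
  obtain ⟨M, hM, h3⟩ := step_trilinear
  set K : ℝ≥0∞ := C2 * (M ^ 2 * C1 ^ 3) with hK
  have hKt : K < ∞ := by
    rw [hK]; exact ENNReal.mul_lt_top hC2 (ENNReal.mul_lt_top (by finiteness) (by finiteness))
  have hK2 : K ^ ((1:ℝ)/2) < ∞ := ENNReal.rpow_lt_top_of_nonneg (by norm_num) hKt.ne
  refine ⟨(K ^ ((1:ℝ)/2)).toReal + 1, by positivity, ?_⟩
  rintro δ ⟨hδ, hδ1⟩ v hv
  have hu := hv.timeMul hψ δ
  have hN := (hu.mul hu).mul hu.conj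
  have hNe : ∀ t' : ℝ, (fun y => ((‖ψ (t' / δ) * v y t'‖ ^ 2 : ℝ) : ℂ) * (ψ (t' / δ) * v y t')) =
      fun y => (fun x t => ((ψ (t / δ) * v x t) * (ψ (t / δ) * v x t)) *
        (starRingEnd ℂ) (ψ (t / δ) * v x t)) y t' := by
    intro t'; ext y
    have := Complex.mul_conj' (ψ (t' / δ) * v y t')
    push_cast
    rw [← this]; ring
  simp only [hNe]
  rw [XNorm_eq, XNorm_eq]
  have main := h2 δ hδ hδ1 _ hN
  have m1 := (X2_mono (show 2 * b - 2 ≤ -4/5 by linarith) _).trans (h3 _ hu)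
  have m2 := h1 δ hδ hδ1 v hv
  have tot : X2 (2 * b) (fun x t => χ (t / δ) *
        ∫ t' in (0:ℝ)..t, schrodingerProp (t - t')
          (fun y => (fun x t => ((ψ (t / δ) * v x t) * (ψ (t / δ) * v x t)) *
        (starRingEnd ℂ) (ψ (t / δ) * v x t)) y t') x) ≤
      K * ENNReal.ofReal (δ ^ (1 - 2 * b + 3/8)) * X2 (2 * b) v ^ 3 := by
    refine main.trans ?_
    calc _ ≤ C2 * ENNReal.ofReal (δ ^ (1 - 2 * b)) *
          (M ^ 2 * (C1 * ENNReal.ofReal (δ ^ ((1:ℝ)/8)) * X2 (2 * b) v) ^ 3) := by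
          gcongr
          refine m1.trans ?_
          gcongr
      _ = K * (ENNReal.ofReal (δ ^ (1 - 2 * b)) * ENNReal.ofReal (δ ^ ((1:ℝ)/8)) ^ 3) *
          X2 (2 * b) v ^ 3 := by rw [hK]; ring
      _ = _ := by
          rw [← ENNReal.ofReal_pow (by positivity), ← ENNReal.ofReal_mul (by positivity),
            ← Real.rpow_natCast, ← Real.rpow_mul hδ.le, ← Real.rpow_add hδ]
          norm_num
  calc _ ≤ (K * ENNReal.ofReal (δ ^ (1 - 2 * b + 3/8)) * X2 (2 * b) v ^ 3) ^ ((1:ℝ)/2) :=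
        ENNReal.rpow_le_rpow tot (by norm_num)
    _ = K ^ ((1:ℝ)/2) * ENNReal.ofReal (δ ^ ((1 - 2 * b) / 2 + 3/16)) *
        (X2 (2 * b) v ^ ((1:ℝ)/2)) ^ 3 := by
        rw [ENNReal.mul_rpow_of_nonneg _ _ (by norm_num), ENNReal.mul_rpow_of_nonneg _ _ (by norm_num),
          ENNReal.ofReal_rpow_of_nonneg (by positivity) (by norm_num), ← Real.rpow_mul hδ.le]
        congr 1
        · congr 3; ring
        · rw [← ENNReal.rpow_natCast, ← ENNReal.rpow_natCast, ← ENNReal.rpow_mul, ← ENNReal.rpow_mul]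
          congr 1; norm_num
    _ ≤ ENNReal.ofReal ((K ^ ((1:ℝ)/2)).toReal + 1) * ENNReal.ofReal (δ ^ r₀) *
        (X2 (2 * b) v ^ ((1:ℝ)/2)) ^ 3 := by
        gcongr ?_ * ?_ * _
        · rw [ENNReal.le_ofReal_iff_toReal_le hK2.ne (by positivity)]; linarith
        · apply ENNReal.ofReal_le_ofReal
          exact Real.rpow_le_rpow_of_exponent_ge hδ hδ1.le hr
    _ = _ := by rw [ENNReal.ofReal_mul (by positivity)]

end assembly

/-- **Cubic Duhamel estimate in `X^{0,b}`.** Let `b ∈ (1/2,1)`, `θ = (b-3/8)/b`,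
`θ₀ = θ/4 + (1-θ)(1-2b)/2`, `r₀ = (1-2b)/2 + 3θ₀ > 0`, and `χ, ψ ∈ C_c^∞(ℝ)`. There is
`C = C(b,χ,ψ)` such that for every `δ ∈ (0,1)` and smooth `v` compactly supported in
time, with `v_δ(x,t) = ψ(t/δ) v(x,t)`, the function
`g(x,t) = χ(t/δ) ∫₀ᵗ (e^{i(t-t')Δ}(|v_δ(·,t')|² v_δ(·,t')))(x) dt'` satisfies
`‖g‖_{X^{0,b}} ≤ C δ^{r₀} ‖v‖_{X^{0,b}}³`. -/
theorem cubic_duhamel_estimate (b θ θ₀ r₀ : ℝ) (hb : b ∈ Set.Ioo (1/2 : ℝ) 1)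
    (hθ : θ = (b - 3/8) / b) (hθ₀ : θ₀ = θ/4 + (1 - θ) * (1 - 2*b) / 2)
    (hr₀ : r₀ = (1 - 2*b)/2 + 3*θ₀) (hpos : 0 < r₀)
    (χ ψ : ℝ → ℂ) (hχ : ContDiff ℝ (⊤ : ℕ∞) χ) (hχc : HasCompactSupport χ)
    (hψ : ContDiff ℝ (⊤ : ℕ∞) ψ) (hψc : HasCompactSupport ψ) :
    ∃ C : ℝ, 0 < C ∧ ∀ δ : ℝ, δ ∈ Set.Ioo (0:ℝ) 1 → ∀ v : ℝ → ℝ → ℂ, SmoothCptTime v →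
      XNorm 0 b (fun x t => χ (t / δ) *
          ∫ t' in (0:ℝ)..t, schrodingerProp (t - t')
            (fun y => ((‖ψ (t' / δ) * v y t'‖ ^ 2 : ℝ) : ℂ) * (ψ (t' / δ) * v y t')) x)
        ≤ ENNReal.ofReal (C * δ ^ r₀) * XNorm 0 b v ^ (3 : ℕ) := by
  exact cubic_main b θ θ₀ r₀ hb hθ hθ₀ hr₀ hpos χ ψ hχ hχc hψ hψc
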